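/- arXiv:1201.2977 — 3 statements merged into one kernel-verified Lean document; each statement's English description precedes it below -/
import Mathlib

section
/- Let {z_I}_{I⊆[n]} be supermodular real parameters with z_∅ = 0 and z_I < z_J whenever I ⊊ J ⊆ [n], and let 0 ≤ q ≤ 1. Let Q(q) = { x ∈ ℝ^n : q·z_I ≤ Σ_{i∈I} x_i ≤ z_{[n]} − z_{[n]∖I} for all I ⊆ [n] } be the full-dimensional projection of the q-lifting of P = P_n({z_I}). Then Q(q) is the union over all ordered partitions π of [n] of the π-liftings P^π(q), and for distinct ordered partitions π ≠ π' the topological interiors of P^π(q) and P^{π'}(q) in ℝ^n are disjoint. -/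
/-- The generalized permutahedron
`P_n({z_I}) = { t ∈ ℝ^n : Σ_i t_i = z_{[n]}, Σ_{i∈I} t_i ≥ z_I for all I }`. -/
def Pz (n : ℕ) (z : Finset (Fin n) → ℝ) : Set (Fin n → ℝ) :=
  {t | ∑ i, t i = z Finset.univ ∧ ∀ I : Finset (Fin n), z I ≤ ∑ i ∈ I, t i}

/-- The union `π_1 ∪ ⋯ ∪ π_j` of the first `j` blocks (inclusive). -/
def unionUpTo {n k : ℕ} (π : Fin k → Finset (Fin n)) (j : Fin k) : Finset (Fin n) :=
  (Finset.univ.filter fun s => s ≤ j).biUnion π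

/-- The union `π_1 ∪ ⋯ ∪ π_{j−1}` of the blocks strictly before `j`. -/
def unionBelow {n k : ℕ} (π : Fin k → Finset (Fin n)) (j : Fin k) : Finset (Fin n) :=
  (Finset.univ.filter fun s => s < j).biUnion π

/-- A canonical linear functional of type `π`: the coefficient of `x_i` is the
index of the block of `π` containing `i`. -/
def typeFun {n k : ℕ} (π : Fin k → Finset (Fin n)) (x : Fin n → ℝ) : ℝ :=
  ∑ s : Fin k, ∑ i ∈ π s, (s : ℝ) * x i

/-- The face `P_π` of `P_n({z_I})`: the set of maximizers over `P_n({z_I})` of a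
linear functional of type `π` (this set depends only on `π`). -/
def Pface {n : ℕ} (k : ℕ) (z : Finset (Fin n) → ℝ) (π : Fin k → Finset (Fin n)) :
    Set (Fin n → ℝ) :=
  {x ∈ Pz n z | ∀ y ∈ Pz n z, typeFun π y ≤ typeFun π x}

/-- The map defining `P_π^i`: multiply by `q` each coordinate indexed by
`π_1 ∪ ⋯ ∪ π_i`, and fix the remaining coordinates. -/
def scaleMap {n k : ℕ} (π : Fin k → Finset (Fin n)) (q : ℝ) (i : Fin (k + 1))
    (x : Fin n → ℝ) : Fin n → ℝ := fun j =>
  if j ∈ (Finset.univ.filter fun s : Fin k => (s : ℕ) < (i : ℕ)).biUnion π then q * x j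
  else x j

/-- The `(π,q)`-lifting `P^π(q)`: the convex hull of `P_π^0 ∪ P_π^1 ∪ ⋯ ∪ P_π^k`. -/
noncomputable def piLift {n : ℕ} (k : ℕ) (z : Finset (Fin n) → ℝ)
    (π : Fin k → Finset (Fin n)) (q : ℝ) : Set (Fin n → ℝ) :=
  convexHull ℝ (⋃ i : Fin (k + 1), scaleMap π q i '' Pface k z π)


/-- An ordered partition `π = π_1|⋯|π_k` of `[n]`: a sequence of disjoint
nonempty blocks whose union is `[n]`. -/
structure OrderedPartition (n : ℕ) where
  k : ℕ
  blocks : Fin k → Finset (Fin n)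
  nonempty_blocks : ∀ i, (blocks i).Nonempty
  disjoint_blocks : ∀ i j, i ≠ j → Disjoint (blocks i) (blocks j)
  covers : ∀ x : Fin n, ∃ i, x ∈ blocks i


open Finset

theorem aux_typeFun {n k : ℕ} (π : Fin k → Finset (Fin n)) (b : Fin n → Fin k)
    (hb : ∀ i s, i ∈ π s ↔ b i = s) (x : Fin n → ℝ) :
    typeFun π x = ∑ i, ((b i : ℕ) : ℝ) * x i := by
  unfold typeFun
  rw [← Finset.sum_fiberwise (s := univ) (g := b)]
  refine Finset.sum_congr rfl fun s _ => ?_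
  have : π s = univ.filter (fun i => b i = s) := by ext i; simp [hb]
  rw [this]
  refine Finset.sum_congr rfl fun i hi => ?_
  rw [(Finset.mem_filter.1 hi).2]

theorem aux_typeFun2 {n k : ℕ} (z : Finset (Fin n) → ℝ) (π : Fin k → Finset (Fin n))
    (b : Fin n → Fin k)
    (hb : ∀ i s, i ∈ π s ↔ b i = s) (x : Fin n → ℝ) (hx : x ∈ Pz n z) :
    typeFun π x = ∑ t : Fin k, (z univ - ∑ i ∈ univ.filter (fun i => b i ≤ t), x i) := by
  rw [aux_typeFun π b hb]
  have h1 : ∀ t : Fin k, z univ - ∑ i ∈ univ.filter (fun i => b i ≤ t), x i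
      = ∑ i, if t < b i then x i else 0 := by
    intro t
    rw [← hx.1, ← Finset.sum_filter_add_sum_filter_not univ (fun i => b i ≤ t) x]
    simp [Finset.sum_filter]
  simp_rw [h1]
  rw [Finset.sum_comm]
  refine Finset.sum_congr rfl fun i _ => ?_
  rw [← Finset.sum_filter, Finset.sum_const, nsmul_eq_mul]
  congr 2
  have : (univ.filter fun t => t < b i) = Finset.Iio (b i) := by ext; simp
  rw [this, Fin.card_Iio]

theorem aux_tight_face {n k : ℕ} (z : Finset (Fin n) → ℝ) (π : Fin k → Finset (Fin n))
    (b : Fin n → Fin k)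
    (hb : ∀ i s, i ∈ π s ↔ b i = s) (x : Fin n → ℝ) (hx : x ∈ Pz n z)
    (ht : ∀ t, ∑ i ∈ univ.filter (fun i => b i ≤ t), x i = z (univ.filter (fun i => b i ≤ t))) :
    x ∈ Pface k z π := by
  refine ⟨hx, fun y hy => ?_⟩
  rw [aux_typeFun2 z π b hb x hx, aux_typeFun2 z π b hb y hy]
  refine Finset.sum_le_sum fun t _ => ?_
  rw [ht]
  linarith [hy.2 (univ.filter (fun i => b i ≤ t))]

theorem aux_greedy {n : ℕ} (z : Finset (Fin n) → ℝ) (hz0 : z ∅ = 0)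
    (hsuper : ∀ I J : Finset (Fin n), z I + z J ≤ z (I ∪ J) + z (I ∩ J))
    (f : Fin n → ℕ) (hf : Function.Injective f) :
    ∃ y : Fin n → ℝ, ∀ I : Finset (Fin n), z I ≤ ∑ i ∈ I, y i ∧
      ((∀ i ∈ I, ∀ j, f j ≤ f i → j ∈ I) → ∑ i ∈ I, y i = z I) := by
  refine ⟨fun i => z (univ.filter (fun j => f j ≤ f i)) - z (univ.filter (fun j => f j < f i)), ?_⟩
  intro I
  induction I using Finset.induction_on_max_value f with
  | empty => simp [hz0]
  | insert a s ha hmax ih =>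
    have hlt : ∀ x ∈ s, f x < f a := fun x hx =>
      lt_of_le_of_ne (hmax x hx) (fun h => ha (hf h ▸ hx))
    rw [Finset.sum_insert ha]
    constructor
    · have h := hsuper (insert a s) (univ.filter (fun j => f j < f a))
      have e1 : insert a s ∪ univ.filter (fun j => f j < f a) = univ.filter (fun j => f j ≤ f a) := by
        ext j
        simp only [mem_union, mem_insert, mem_filter, mem_univ, true_and]
        constructor
        · rintro ((rfl | h) | h)
          · exact le_rfl
          · exact hmax _ h
          · exact h.le
        · intro h
          rcases h.lt_or_eq with h | h
          · exact Or.inr h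
          · exact Or.inl (Or.inl (hf h))
      have e2 : insert a s ∩ univ.filter (fun j => f j < f a) = s := by
        ext j
        simp only [mem_inter, mem_insert, mem_filter, mem_univ, true_and]
        constructor
        · rintro ⟨rfl | h, h'⟩
          · exact absurd h' (lt_irrefl _)
          · exact h
        · intro h
          exact ⟨Or.inr h, hlt _ h⟩
      rw [e1, e2] at h
      linarith [ih.1]
    · intro hl
      have e1 : insert a s = univ.filter (fun j => f j ≤ f a) := by
        ext j
        simp only [mem_insert, mem_filter, mem_univ, true_and]
        constructor
        · rintro (rfl | h)
          · exact le_rfl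
          · exact hmax _ h
        · intro h
          simpa using hl a (by simp) j h
      have e2 : s = univ.filter (fun j => f j < f a) := by
        ext j
        simp only [mem_filter, mem_univ, true_and]
        constructor
        · exact hlt j
        · intro h
          have := hl a (by simp) j h.le
          rcases Finset.mem_insert.1 this with rfl | h'
          · exact absurd h (lt_irrefl _)
          · exact h'
      rw [ih.2, e1, ← e2]
      · ring
      · intro i hi j hj
        have := hl i (by simp [hi]) j hj
        rcases Finset.mem_insert.1 this with rfl | h'
        · exact absurd (hlt i hi) (not_lt.2 hj)
        · exact h'

theorem aux_face_tight {n k : ℕ} (z : Finset (Fin n) → ℝ) (hz0 : z ∅ = 0)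
    (hsuper : ∀ I J : Finset (Fin n), z I + z J ≤ z (I ∪ J) + z (I ∩ J))
    (π : Fin k → Finset (Fin n)) (b : Fin n → Fin k)
    (hb : ∀ i s, i ∈ π s ↔ b i = s) (x : Fin n → ℝ) (hx : x ∈ Pface k z π) (t : Fin k) :
    ∑ i ∈ univ.filter (fun i => b i ≤ t), x i = z (univ.filter (fun i => b i ≤ t)) := by
  obtain ⟨hxP, hmax⟩ := hx
  have key : ∀ i j : Fin n, (b j : ℕ) * n + j ≤ (b i : ℕ) * n + i → b j ≤ b i := by
    intro i j h
    by_contra hc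
    have hc : (b i : ℕ) + 1 ≤ b j := by simpa using hc
    have h2 : ((b i : ℕ) + 1) * n ≤ (b j : ℕ) * n := Nat.mul_le_mul_right _ hc
    have := i.2
    rw [add_mul] at h2
    omega
  obtain ⟨y, hy⟩ := aux_greedy z hz0 hsuper (fun i => (b i : ℕ) * n + i) (by
    intro i j h
    have h : (b i : ℕ) * n + i = (b j : ℕ) * n + j := h
    have h1 := le_antisymm (key j i h.le) (key i j h.ge)
    rw [h1] at h
    exact Fin.ext (by omega))
  have hyP : y ∈ Pz n z := ⟨(hy univ).2 (by simp), fun I => (hy I).1⟩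
  have hyt : ∀ t, ∑ i ∈ univ.filter (fun i => b i ≤ t), y i
      = z (univ.filter (fun i => b i ≤ t)) := by
    intro t
    refine (hy _).2 ?_
    intro i hi j hj
    simp only [mem_filter, mem_univ, true_and] at hi ⊢
    exact (key i j hj).trans hi
  have h := hmax y hyP
  rw [aux_typeFun2 z π b hb x hxP, aux_typeFun2 z π b hb y hyP] at h
  by_contra hne
  refine absurd h (not_le.2 (Finset.sum_lt_sum (fun s _ => ?_) ⟨t, mem_univ _, ?_⟩))
  · rw [hyt]; linarith [hxP.2 (univ.filter (fun i => b i ≤ s))]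
  · rw [hyt]
    have := lt_of_le_of_ne (hxP.2 (univ.filter (fun i => b i ≤ t))) (Ne.symm hne)
    linarith

theorem aux_pos {n : ℕ} (z : Finset (Fin n) → ℝ) (hz0 : z ∅ = 0)
    (hstrict : ∀ I J : Finset (Fin n), I ⊂ J → z I < z J) (y : Fin n → ℝ) (hy : y ∈ Pz n z)
    (i : Fin n) : 0 < y i := by
  have h1 := hy.2 {i}
  have h2 := hstrict ∅ {i} (by simp)
  rw [hz0] at h2
  simp at h1
  linarith

theorem aux_scale {n k : ℕ} (π : Fin k → Finset (Fin n)) (b : Fin n → Fin k)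
    (hb : ∀ i s, i ∈ π s ↔ b i = s) (q : ℝ) (i : Fin (k + 1)) (x : Fin n → ℝ) (j : Fin n) :
    scaleMap π q i x j = (if (b j : ℕ) < i then q else 1) * x j := by
  unfold scaleMap
  simp [hb]

theorem aux_blk {n : ℕ} (π : OrderedPartition n) :
    ∃ b : Fin n → Fin π.k, ∀ i s, i ∈ π.blocks s ↔ b i = s := by
  choose b hb using π.covers
  refine ⟨b, fun i s => ⟨fun h => ?_, fun h => h ▸ hb i⟩⟩
  by_contra hne
  exact Finset.disjoint_left.1 (π.disjoint_blocks _ _ hne) (hb i) h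

theorem aux_sub {n k : ℕ} (z : Finset (Fin n) → ℝ) (hz0 : z ∅ = 0)
    (hstrict : ∀ I J : Finset (Fin n), I ⊂ J → z I < z J)
    (q : ℝ) (hq0 : 0 ≤ q) (hq1 : q ≤ 1)
    (π : Fin k → Finset (Fin n)) (b : Fin n → Fin k)
    (hb : ∀ i s, i ∈ π s ↔ b i = s) :
    piLift k z π q ⊆ {x : Fin n → ℝ | ∀ I : Finset (Fin n),
        q * z I ≤ ∑ i ∈ I, x i ∧ ∑ i ∈ I, x i ≤ z Finset.univ - z Iᶜ} := by
  refine convexHull_min ?_ ?_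
  · rintro x hx
    obtain ⟨s, y, hy, rfl⟩ := Set.mem_iUnion.1 hx
    have hpos := aux_pos z hz0 hstrict y hy.1
    intro I
    simp_rw [aux_scale π b hb]
    constructor
    · calc q * z I ≤ q * ∑ i ∈ I, y i := mul_le_mul_of_nonneg_left (hy.1.2 I) hq0
        _ = ∑ i ∈ I, q * y i := Finset.mul_sum _ _ _
        _ ≤ _ := Finset.sum_le_sum fun i _ => by
          refine mul_le_mul_of_nonneg_right ?_ (hpos i).le
          split_ifs <;> linarith
    · calc _ ≤ ∑ i ∈ I, y i := Finset.sum_le_sum fun i _ => by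
            refine mul_le_of_le_one_left (hpos i).le ?_
            split_ifs <;> linarith
        _ ≤ _ := by
          have := hy.1.2 Iᶜ
          rw [← hy.1.1, ← Finset.sum_add_sum_compl I y]
          linarith
  · intro x hx y hy a c ha hc hac I
    have e : ∑ i ∈ I, (a • x + c • y) i = a * ∑ i ∈ I, x i + c * ∑ i ∈ I, y i := by
      simp [Finset.sum_add_distrib, Finset.mul_sum]
    rw [e]
    obtain rfl : c = 1 - a := by linarith
    constructor
    · nlinarith [(hx I).1, (hy I).1]
    · nlinarith [(hx I).2, (hy I).2]

theorem aux_step {n : ℕ} (z : Finset (Fin n) → ℝ)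
    (hstrict : ∀ I J : Finset (Fin n), I ⊂ J → z I < z J)
    (x : Fin n → ℝ) (hx0 : ∀ i, 0 ≤ x i) (A : Finset (Fin n)) (hA : A ≠ univ) (μ : ℝ) (hμ : 0 ≤ μ)
    (hlow : ∀ B, A ⊆ B → μ * (z B - z A) ≤ ∑ i ∈ B \ A, x i) :
    ∃ (B : Finset (Fin n)) (ν : ℝ) (w : Fin n → ℝ), A ⊂ B ∧ μ ≤ ν ∧
      (∀ C, A ⊆ C → ν * (z C - z A) ≤ ∑ i ∈ C \ A, x i) ∧
      (∀ i ∈ B \ A, x i = ν * w i) ∧ ∑ i ∈ B \ A, w i = z B - z A ∧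
      ∀ C, A ⊆ C → C ⊆ B → z C - z A ≤ ∑ i ∈ C \ A, w i := by
  have hAu : A ⊂ univ := Finset.ssubset_univ_iff.2 hA
  by_cases hzero : ∃ i, i ∉ A ∧ x i = 0
  · obtain ⟨i, hi, hxi⟩ := hzero
    have hd : insert i A \ A = {i} := by
      ext j
      simp only [mem_sdiff, mem_insert, mem_singleton]
      constructor
      · rintro ⟨rfl | h, h'⟩
        · rfl
        · exact absurd h h'
      · rintro rfl
        exact ⟨Or.inl rfl, hi⟩
    have hss : A ⊂ insert i A := Finset.ssubset_insert hi
    refine ⟨insert i A, 0, fun _ => z (insert i A) - z A, hss, ?_, ?_, ?_, ?_, ?_⟩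
    · have := hlow _ hss.1
      rw [hd, Finset.sum_singleton, hxi] at this
      have h2 := hstrict _ _ hss
      by_contra hc
      push Not at hc
      have := mul_pos hc (sub_pos.2 h2)
      linarith
    · intro C _
      rw [zero_mul]
      exact Finset.sum_nonneg fun i _ => hx0 i
    · intro j hj
      rw [hd, Finset.mem_singleton] at hj
      rw [hj, hxi, zero_mul]
    · rw [hd, Finset.sum_singleton]
    · intro C h1 h2
      by_cases hiC : i ∈ C
      · have : C = insert i A := Finset.Subset.antisymm h2 (Finset.insert_subset hiC h1)
        rw [this, hd, Finset.sum_singleton]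
      · have : C = A := by
          refine Finset.Subset.antisymm (fun j hj => ?_) h1
          rcases Finset.mem_insert.1 (h2 hj) with rfl | h
          · exact absurd hj hiC
          · exact h
        rw [this]; simp
  · push Not at hzero
    have hpos : ∀ i, i ∉ A → 0 < x i := fun i hi => lt_of_le_of_ne (hx0 i) (Ne.symm (hzero i hi))
    obtain ⟨B, hB, hmin⟩ := Finset.exists_min_image (univ.filter fun B : Finset (Fin n) => A ⊂ B)
      (fun B => (∑ i ∈ B \ A, x i) / (z B - z A)) ⟨univ, by simpa using hAu⟩
    have hB : A ⊂ B := by simpa using hB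
    have hzB := sub_pos.2 (hstrict _ _ hB)
    have hxB : 0 < ∑ i ∈ B \ A, x i := by
      refine Finset.sum_pos (fun i hi => hpos i (Finset.mem_sdiff.1 hi).2) ?_
      exact Finset.sdiff_nonempty.2 hB.2
    set ν := (∑ i ∈ B \ A, x i) / (z B - z A) with hν
    have hνpos : 0 < ν := div_pos hxB hzB
    have hall : ∀ C, A ⊆ C → ν * (z C - z A) ≤ ∑ i ∈ C \ A, x i := by
      intro C hC
      rcases hC.eq_or_ssubset with rfl | hC
      · simp
      · have := hmin C (by simpa using hC)
        exact (le_div_iff₀ (sub_pos.2 (hstrict _ _ hC))).1 this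
    refine ⟨B, ν, fun i => x i / ν, hB, ?_, hall, ?_, ?_, ?_⟩
    · rw [hν, le_div_iff₀ hzB]; exact hlow B hB.1
    · intro i _
      field_simp
    · rw [← Finset.sum_div, hν]
      field_simp
    · intro C h1 _
      rw [← Finset.sum_div, le_div_iff₀ hνpos]
      linarith [hall C h1]

theorem aux_rec {n : ℕ} (z : Finset (Fin n) → ℝ)
    (hsuper : ∀ I J : Finset (Fin n), z I + z J ≤ z (I ∪ J) + z (I ∩ J))
    (hstrict : ∀ I J : Finset (Fin n), I ⊂ J → z I < z J)
    (x : Fin n → ℝ) (hx0 : ∀ i, 0 ≤ x i)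
    (hup : ∀ A : Finset (Fin n), ∑ i ∈ univ \ A, x i ≤ z univ - z A) (m : ℕ) :
    ∀ (A : Finset (Fin n)) (μ : ℝ), (univ \ A).card ≤ m → 0 ≤ μ →
    (∀ B, A ⊆ B → μ * (z B - z A) ≤ ∑ i ∈ B \ A, x i) →
    ∃ c y : Fin n → ℝ, (∀ i, i ∉ A → x i = c i * y i ∧ μ ≤ c i ∧ c i ≤ 1) ∧
      (∀ t, ∑ i ∈ univ.filter (fun i => i ∉ A ∧ c i ≤ t), y i
        = z (A ∪ univ.filter (fun i => i ∉ A ∧ c i ≤ t)) - z A) ∧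
      (∀ B, A ⊆ B → z B - z A ≤ ∑ i ∈ B \ A, y i) := by
  induction m with
  | zero =>
    intro A μ hA _ _
    have hA : A = univ := by
      have := Finset.card_eq_zero.1 (Nat.le_zero.1 hA)
      exact Finset.eq_univ_iff_forall.2 fun i => Finset.sdiff_eq_empty_iff_subset.1 this (mem_univ i)
    subst hA
    refine ⟨0, 0, by simp, by simp, ?_⟩
    intro B hB
    rw [Finset.univ_subset_iff.1 hB]; simp
  | succ m ih =>
    intro A μ hA hμ hlow
    by_cases hAu : A = univ
    · exact ih A μ (by rw [hAu]; simp) hμ hlow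
    obtain ⟨B, ν, w, hAB, hμν, hall, hxw, hwB, hwC⟩ := aux_step z hstrict x hx0 A hAu μ hμ hlow
    have hsplit : ∀ C, B ⊆ C → ∀ f : Fin n → ℝ,
        ∑ i ∈ C \ A, f i = ∑ i ∈ B \ A, f i + ∑ i ∈ C \ B, f i := by
      intro C hC f
      rw [← Finset.sum_union]
      · congr 1
        ext i
        have h1 := @hC i
        have h2 := @hAB.1 i
        simp only [mem_sdiff, mem_union]
        tauto
      · rw [Finset.disjoint_left]
        intro i
        simp only [mem_sdiff]
        tauto
    have hxB : ∑ i ∈ B \ A, x i = ν * (z B - z A) := by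
      rw [← hwB, Finset.mul_sum]
      exact Finset.sum_congr rfl hxw
    obtain ⟨c, y, h1, h2, h3⟩ := ih B ν (by
        have : univ \ B ⊂ univ \ A := by
          rw [Finset.ssubset_iff_of_subset (Finset.sdiff_subset_sdiff le_rfl hAB.1)]
          obtain ⟨i, hi, hi'⟩ := Finset.exists_of_ssubset hAB
          exact ⟨i, by simp [hi'], by simp [hi]⟩
        have := Finset.card_lt_card this
        omega) (hμ.trans hμν) (by
        intro C hC
        have := hall C (hAB.1.trans hC)
        rw [hsplit C hC, hxB] at this
        linarith)
    have hν1 : ν ≤ 1 := by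
      have a1 := hall univ (Finset.subset_univ _)
      have a2 := hup A
      have a3 := hstrict A univ (Finset.ssubset_univ_iff.2 hAu)
      by_contra hc
      push Not at hc
      have := mul_lt_mul_of_pos_right hc (sub_pos.2 a3)
      linarith
    have hysum : ∀ S : Finset (Fin n), S ⊆ B → ∑ i ∈ S, (if i ∈ B then w i else y i) = ∑ i ∈ S, w i := by
      intro S hS
      exact Finset.sum_congr rfl fun i hi => if_pos (hS hi)
    have hysum' : ∀ S : Finset (Fin n), (∀ i ∈ S, i ∉ B) →
        ∑ i ∈ S, (if i ∈ B then w i else y i) = ∑ i ∈ S, y i := by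
      intro S hS
      exact Finset.sum_congr rfl fun i hi => if_neg (hS i hi)
    refine ⟨fun i => if i ∈ B then ν else c i, fun i => if i ∈ B then w i else y i, ?_, ?_, ?_⟩
    · intro i hi
      by_cases hiB : i ∈ B
      · simp only [hiB, if_true]
        exact ⟨hxw i (by simp [hi, hiB]), hμν, hν1⟩
      · simp only [hiB, if_false]
        obtain ⟨b1, b2, b3⟩ := h1 i hiB
        exact ⟨b1, hμν.trans b2, b3⟩
    · intro t
      by_cases ht : ν ≤ t
      · set L := univ.filter (fun i => i ∉ B ∧ c i ≤ t) with hL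
        have e : univ.filter (fun i => i ∉ A ∧ (if i ∈ B then ν else c i) ≤ t) = (B ∪ L) \ A := by
          ext i
          have := @hAB.1 i
          by_cases hiB : i ∈ B <;> simp [hL, hiB, ht] <;> tauto
        have e2 : (B ∪ L) \ B = L := by
          ext i
          simp only [hL, mem_sdiff, mem_union, mem_filter, mem_univ, true_and]
          tauto
        have e3 : A ∪ (B ∪ L) \ A = B ∪ L := by
          rw [Finset.union_sdiff_of_subset (hAB.1.trans Finset.subset_union_left)]
        rw [e, e3, hsplit _ Finset.subset_union_left, e2, hysum _ Finset.sdiff_subset,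
          hysum' L (by simp [hL]; tauto), hwB, h2 t]
        ring
      · have e : univ.filter (fun i => i ∉ A ∧ (if i ∈ B then ν else c i) ≤ t) = ∅ := by
          ext i
          by_cases hiB : i ∈ B
          · simp [hiB, ht]
          · have := (h1 i hiB).2.1
            simp only [mem_filter, mem_univ, true_and, hiB, if_false, Finset.notMem_empty, iff_false]
            rintro ⟨_, h⟩
            linarith
        rw [e]; simp
    · intro C hC
      have e : C \ A = (C ∩ B) \ A ∪ (C ∪ B) \ B := by
        ext i
        have := @hAB.1 i
        simp only [mem_sdiff, mem_union, mem_inter]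
        tauto
      rw [e, Finset.sum_union, hysum, hysum']
      · have b1 := hwC (C ∩ B) (Finset.subset_inter hC hAB.1) Finset.inter_subset_right
        have b2 := h3 (C ∪ B) Finset.subset_union_right
        have b3 := hsuper C B
        linarith
      · simp
      · exact Finset.sdiff_subset.trans Finset.inter_subset_right
      · rw [Finset.disjoint_left]
        intro i
        simp only [mem_sdiff, mem_inter]
        tauto

theorem aux_decomp {n : ℕ} (z : Finset (Fin n) → ℝ) (hz0 : z ∅ = 0)
    (hsuper : ∀ I J : Finset (Fin n), z I + z J ≤ z (I ∪ J) + z (I ∩ J))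
    (hstrict : ∀ I J : Finset (Fin n), I ⊂ J → z I < z J)
    (q : ℝ) (hq0 : 0 ≤ q) (x : Fin n → ℝ)
    (hx : ∀ I : Finset (Fin n),
        q * z I ≤ ∑ i ∈ I, x i ∧ ∑ i ∈ I, x i ≤ z Finset.univ - z Iᶜ) :
    ∃ c y : Fin n → ℝ, y ∈ Pz n z ∧ (∀ i, x i = c i * y i ∧ q ≤ c i ∧ c i ≤ 1) ∧
      ∀ t, ∑ i ∈ univ.filter (fun i => c i ≤ t), y i = z (univ.filter (fun i => c i ≤ t)) := by
  have hx0 : ∀ i, 0 ≤ x i := by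
    intro i
    have h1 := (hx {i}).1
    have h2 := hstrict ∅ {i} (by simp)
    rw [hz0] at h2
    rw [Finset.sum_singleton] at h1
    exact (mul_nonneg hq0 h2.le).trans h1
  obtain ⟨c, y, h1, h2, h3⟩ := aux_rec z hsuper hstrict x hx0 (by
    intro A
    have := (hx (univ \ A)).2
    rwa [← Finset.compl_eq_univ_sdiff, compl_compl] at this) _ ∅ q le_rfl hq0 (by
    intro B _
    simpa [hz0] using (hx B).1)
  have h2 : ∀ t, ∑ i ∈ univ.filter (fun i => c i ≤ t), y i = z (univ.filter (fun i => c i ≤ t)) := by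
    simpa [hz0] using h2
  refine ⟨c, y, ⟨?_, ?_⟩, ?_, h2⟩
  · have := h2 1
    rwa [Finset.filter_true_of_mem (fun i _ => (h1 i (by simp)).2.2)] at this
  · intro I
    simpa [hz0] using h3 I (by simp)
  · intro i
    exact h1 i (by simp)

theorem aux_hull {n k : ℕ} (z : Finset (Fin n) → ℝ) (π : Fin k → Finset (Fin n))
    (b : Fin n → Fin k) (hb : ∀ i s, i ∈ π s ↔ b i = s) (q : ℝ) (hq1 : q ≤ 1)
    (y : Fin n → ℝ) (hy : y ∈ Pface k z π) (m : Fin k → ℝ) (hm : Monotone m)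
    (hm0 : ∀ s, q ≤ m s) (hm1 : ∀ s, m s ≤ 1) :
    (fun i => m (b i) * y i) ∈ piLift k z π q := by
  have hmem : ∀ i : Fin (k + 1), scaleMap π q i y ∈ ⋃ i : Fin (k + 1), scaleMap π q i '' Pface k z π :=
    fun i => Set.mem_iUnion.2 ⟨i, y, hy, rfl⟩
  rcases hq1.eq_or_lt with rfl | hq
  · have : (fun i => m (b i) * y i) = scaleMap π 1 0 y := by
      ext i
      rw [aux_scale π b hb, le_antisymm (hm1 (b i)) (hm0 (b i))]
      simp
    rw [this]
    exact subset_convexHull _ _ (hmem 0)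
  · set M : ℕ → ℝ := fun i => if i = 0 then q else if h : i - 1 < k then m ⟨i - 1, h⟩ else 1 with hM
    have M0 : M 0 = q := by simp [hM]
    have Mk : M (k + 1) = 1 := by simp [hM]
    have Ms : ∀ s : Fin k, M (s + 1) = m s := by intro s; simp [hM]
    have Mmono : Monotone M := by
      refine monotone_nat_of_le_succ fun i => ?_
      rcases Nat.eq_zero_or_pos i with rfl | hi
      · rw [M0]
        by_cases h : 0 < k
        · simp [hM, h, hm0]
        · simp [hM, h, hq.le]
      · have hi0 : i ≠ 0 := hi.ne'
        by_cases h : i < k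
        · have h' : i - 1 < k := by omega
          simp only [hM, hi0, if_false, h', dif_pos, Nat.add_sub_cancel, h, Nat.succ_ne_zero]
          exact hm (by simp [Fin.le_def])
        · by_cases h' : i - 1 < k
          · simp [hM, hi0, h, h', hm1]
          · simp [hM, hi0, h, h']
    have hq' : 0 < 1 - q := sub_pos.2 hq
    have hsum : ∀ s : ℕ, s < k → ∑ i : Fin (k + 1), (M (i + 1) - M i) / (1 - q) *
        (if s < (i : ℕ) then q else 1) = M (s + 1) := by
      intro s hs
      rw [Fin.sum_univ_eq_sum_range (fun i => (M (i + 1) - M i) / (1 - q) *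
        (if s < i then q else 1))]
      have e : ∀ i, (M (i + 1) - M i) / (1 - q) * (if s < i then q else 1)
          = (M (i + 1) - M i) / (1 - q) - (M (max (i + 1) (s + 1)) - M (max i (s + 1))) := by
        intro i
        split_ifs with h
        · rw [max_eq_left (by omega), max_eq_left (by omega)]
          field_simp
          ring
        · rw [max_eq_right (by omega), max_eq_right (by omega)]
          ring
      simp_rw [e]
      rw [Finset.sum_sub_distrib, ← Finset.sum_div, Finset.sum_range_sub M,
        Finset.sum_range_sub (fun i => M (max i (s + 1))), max_eq_left (by omega),
        max_eq_right (by omega), Mk, M0, div_self hq'.ne']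
      ring
    have : (fun i => m (b i) * y i) =
        ∑ i : Fin (k + 1), ((M (i + 1) - M i) / (1 - q)) • scaleMap π q i y := by
      ext j
      rw [Finset.sum_apply]
      simp only [Pi.smul_apply, smul_eq_mul, aux_scale π b hb, ← mul_assoc]
      rw [← Finset.sum_mul, hsum _ (b j).2, Ms]
    rw [this]
    refine (convex_convexHull ℝ _).sum_mem (fun i _ => ?_) ?_
      (fun i _ => subset_convexHull _ _ (hmem i))
    · exact div_nonneg (sub_nonneg.2 (Mmono (Nat.le_succ _))) hq'.le
    · rw [Fin.sum_univ_eq_sum_range (fun i => (M (i + 1) - M i) / (1 - q)), ← Finset.sum_div,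
        Finset.sum_range_sub M, Mk, M0, div_self hq'.ne']

theorem aux_sup {n : ℕ} (z : Finset (Fin n) → ℝ) (hz0 : z ∅ = 0)
    (hsuper : ∀ I J : Finset (Fin n), z I + z J ≤ z (I ∪ J) + z (I ∩ J))
    (hstrict : ∀ I J : Finset (Fin n), I ⊂ J → z I < z J)
    (q : ℝ) (hq0 : 0 ≤ q) (hq1 : q ≤ 1) (x : Fin n → ℝ)
    (hx : ∀ I : Finset (Fin n),
        q * z I ≤ ∑ i ∈ I, x i ∧ ∑ i ∈ I, x i ≤ z Finset.univ - z Iᶜ) :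
    ∃ π : OrderedPartition n, x ∈ piLift π.k z π.blocks q := by
  obtain ⟨c, y, hy, hc, ht⟩ := aux_decomp z hz0 hsuper hstrict q hq0 x hx
  set S := univ.image c with hS
  set e := S.orderIsoOfFin rfl with he
  have hcS : ∀ i, c i ∈ S := fun i => Finset.mem_image_of_mem _ (mem_univ i)
  let b : Fin n → Fin S.card := fun i => e.symm ⟨c i, hcS i⟩
  have heb : ∀ i, (e (b i) : ℝ) = c i := fun i => by simp [b]
  let π : OrderedPartition n :=
    { k := S.card
      blocks := fun s => univ.filter fun i => b i = s
      nonempty_blocks := by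
        intro s
        obtain ⟨i, _, hi⟩ := Finset.mem_image.1 (e s).2
        refine ⟨i, ?_⟩
        simp only [mem_filter, mem_univ, true_and]
        apply e.injective
        apply Subtype.ext
        rw [heb, hi]
      disjoint_blocks := by
        intro s t hst
        rw [Finset.disjoint_left]
        intro i
        simp only [mem_filter, mem_univ, true_and]
        rintro rfl h
        exact hst h
      covers := fun i => ⟨b i, by simp⟩ }
  have hb : ∀ i s, i ∈ π.blocks s ↔ b i = s := by intro i s; simp [π]
  refine ⟨π, ?_⟩
  have hx' : x = fun i => (e (b i) : ℝ) * y i := by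
    ext i
    rw [heb, (hc i).1]
  rw [hx']
  refine aux_hull z π.blocks b hb q hq1 y (aux_tight_face z π.blocks b hb y hy ?_)
    (fun s => (e s : ℝ)) (fun s t h => e.monotone h) ?_ ?_
  · intro t
    have : (univ.filter fun i => b i ≤ t) = univ.filter fun i => c i ≤ (e t : ℝ) := by
      ext i
      simp only [mem_filter, mem_univ, true_and]
      rw [← heb i, Subtype.coe_le_coe, e.le_iff_le]
    rw [this]
    exact ht _
  · intro s
    obtain ⟨i, _, hi⟩ := Finset.mem_image.1 (e s).2
    rw [← hi]; exact (hc i).2.1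
  · intro s
    obtain ⟨i, _, hi⟩ := Finset.mem_image.1 (e s).2
    rw [← hi]; exact (hc i).2.2

/-- Slope of block `j`. -/
noncomputable def auxMu {n k : ℕ} (z : Finset (Fin n) → ℝ) (b : Fin n → Fin k) (j : Fin k)
    (x : Fin n → ℝ) : ℝ :=
  (∑ i ∈ univ.filter (fun i => b i = j), x i) /
    (z (univ.filter fun i => b i ≤ j) - z (univ.filter fun i => b i < j))

theorem auxMu_comb {n k : ℕ} (z : Finset (Fin n) → ℝ) (b : Fin n → Fin k) (j : Fin k)
    (x y : Fin n → ℝ) (a c : ℝ) :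
    auxMu z b j (a • x + c • y) = a * auxMu z b j x + c * auxMu z b j y := by
  unfold auxMu
  simp only [Pi.add_apply, Pi.smul_apply, smul_eq_mul, Finset.sum_add_distrib, ← Finset.mul_sum]
  ring

theorem aux_dpos {n k : ℕ} (z : Finset (Fin n) → ℝ)
    (hstrict : ∀ I J : Finset (Fin n), I ⊂ J → z I < z J)
    (b : Fin n → Fin k) (hsurj : Function.Surjective b) (j : Fin k) :
    0 < z (univ.filter fun i => b i ≤ j) - z (univ.filter fun i => b i < j) := by
  refine sub_pos.2 (hstrict _ _ ?_)
  obtain ⟨i, hi⟩ := hsurj j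
  rw [Finset.ssubset_iff_of_subset]
  · exact ⟨i, by simp [hi], by simp [hi]⟩
  · intro a
    simp only [mem_filter, mem_univ, true_and]
    exact le_of_lt

theorem aux_split {n k : ℕ} (b : Fin n → Fin k) (j : Fin k) (x : Fin n → ℝ) :
    ∑ i ∈ univ.filter (fun i => b i ≤ j), x i =
      ∑ i ∈ univ.filter (fun i => b i < j), x i + ∑ i ∈ univ.filter (fun i => b i = j), x i := by
  rw [← Finset.sum_union]
  · congr 1
    ext i
    simp [le_iff_lt_or_eq]
  · rw [Finset.disjoint_left]
    intro i
    simp only [mem_filter, mem_univ, true_and]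
    exact fun h => h.ne

/-- linear conditions on the lifting -/
def AuxGood {n k : ℕ} (z : Finset (Fin n) → ℝ) (b : Fin n → Fin k) (x : Fin n → ℝ) : Prop :=
  (∀ j, 0 ≤ auxMu z b j x) ∧ (∀ j j', j ≤ j' → auxMu z b j x ≤ auxMu z b j' x) ∧
  ∀ j (B : Finset (Fin n)), ∑ i ∈ univ.filter (fun i => b i ≤ j), x i
      - auxMu z b j x * z (univ.filter (fun i => b i ≤ j)) ≤ ∑ i ∈ B, x i - auxMu z b j x * z B

theorem aux_good {n k : ℕ} (z : Finset (Fin n) → ℝ) (hz0 : z ∅ = 0)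
    (hsuper : ∀ I J : Finset (Fin n), z I + z J ≤ z (I ∪ J) + z (I ∩ J))
    (hstrict : ∀ I J : Finset (Fin n), I ⊂ J → z I < z J)
    (q : ℝ) (hq0 : 0 ≤ q) (hq1 : q ≤ 1)
    (π : Fin k → Finset (Fin n)) (b : Fin n → Fin k)
    (hb : ∀ i s, i ∈ π s ↔ b i = s) (hsurj : Function.Surjective b) :
    piLift k z π q ⊆ {x | AuxGood z b x} := by
  refine convexHull_min ?_ ?_
  · rintro x hx
    obtain ⟨s, y, hy, rfl⟩ := Set.mem_iUnion.1 hx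
    have hpos := aux_pos z hz0 hstrict y hy.1
    have htight := aux_face_tight z hz0 hsuper π b hb y hy
    have hlo : ∀ j : Fin k, ∑ i ∈ univ.filter (fun i => b i < j), y i
        = z (univ.filter fun i => b i < j) := by
      intro j
      by_cases h0 : (j : ℕ) = 0
      · have : (univ.filter fun i => b i < j) = ∅ := by
          ext i; simp [Fin.le_def, h0]
        rw [this, hz0]; simp
      · have : (univ.filter fun i => b i < j) =
            univ.filter fun i => b i ≤ ⟨j - 1, by omega⟩ := by
          ext i
          simp only [mem_filter, mem_univ, true_and, Fin.le_def, Fin.lt_def]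
          omega
        rw [this]
        exact htight _
    set σ : Fin k → ℝ := fun j => if (j : ℕ) < s then q else 1 with hσ
    have hx : scaleMap π q s y = fun i => σ (b i) * y i := by
      ext i; rw [aux_scale π b hb]
    have hσmono : Monotone σ := by
      intro j j' h
      have h : (j : ℕ) ≤ j' := h
      simp only [hσ]
      split_ifs
      · exact le_rfl
      · exact hq1
      · omega
      · exact le_rfl
    have hσ0 : ∀ j, 0 ≤ σ j := by
      intro j
      simp only [hσ]
      split_ifs
      · exact hq0
      · exact zero_le_one
    rw [hx]
    have hμ : ∀ j, auxMu z b j (fun i => σ (b i) * y i) = σ j := by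
      intro j
      unfold auxMu
      have e : ∑ i ∈ univ.filter (fun i => b i = j), σ (b i) * y i
          = σ j * ∑ i ∈ univ.filter (fun i => b i = j), y i := by
        rw [Finset.mul_sum]
        refine Finset.sum_congr rfl fun i hi => ?_
        rw [(Finset.mem_filter.1 hi).2]
      have e2 := aux_split b j y
      rw [htight, hlo] at e2
      have hd := aux_dpos z hstrict b hsurj j
      rw [e, div_eq_iff hd.ne']
      rw [e2]; ring
    refine ⟨fun j => ?_, fun j j' h => ?_, fun j B => ?_⟩
    · rw [hμ]; exact hσ0 j
    · rw [hμ, hμ]; exact hσmono h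
    · rw [hμ, ← htight j]
      have h1 : σ j * z B ≤ σ j * ∑ i ∈ B, y i := mul_le_mul_of_nonneg_left (hy.1.2 B) (hσ0 j)
      have h2 : ∑ i ∈ univ.filter (fun i => b i ≤ j), (σ (b i) - σ j) * y i
          ≤ ∑ i ∈ B, (σ (b i) - σ j) * y i := by
        rw [Finset.sum_filter, ← Finset.univ_inter B, ← Finset.sum_ite_mem]
        refine Finset.sum_le_sum fun i _ => ?_
        by_cases hi : b i ≤ j
        · have := mul_nonpos_of_nonpos_of_nonneg (sub_nonpos.2 (hσmono hi)) (hpos i).le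
          split_ifs <;> linarith
        · have := mul_nonneg (sub_nonneg.2 (hσmono (not_le.1 hi).le)) (hpos i).le
          split_ifs <;> linarith
      simp only [sub_mul, Finset.sum_sub_distrib, ← Finset.mul_sum] at h2
      linarith
  · rintro x ⟨hx0, hx1, hx2⟩ y ⟨hy0, hy1, hy2⟩ a c ha hc hac
    refine ⟨fun j => ?_, fun j j' h => ?_, fun j B => ?_⟩
    · rw [auxMu_comb]
      exact add_nonneg (mul_nonneg ha (hx0 j)) (mul_nonneg hc (hy0 j))
    · rw [auxMu_comb, auxMu_comb]
      exact add_le_add (mul_le_mul_of_nonneg_left (hx1 _ _ h) ha)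
        (mul_le_mul_of_nonneg_left (hy1 _ _ h) hc)
    · rw [auxMu_comb]
      have e : ∀ I : Finset (Fin n), ∑ i ∈ I, (a • x + c • y) i
          = a * ∑ i ∈ I, x i + c * ∑ i ∈ I, y i := by
        intro I
        simp [Finset.sum_add_distrib, Finset.mul_sum]
      rw [e, e]
      have := mul_le_mul_of_nonneg_left (hx2 j B) ha
      have := mul_le_mul_of_nonneg_left (hy2 j B) hc
      linarith

theorem aux_strict {n k : ℕ} (z : Finset (Fin n) → ℝ)
    (hstrict : ∀ I J : Finset (Fin n), I ⊂ J → z I < z J)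
    (b : Fin n → Fin k) (hsurj : Function.Surjective b) (S : Set (Fin n → ℝ))
    (hS : S ⊆ {x | AuxGood z b x}) (x : Fin n → ℝ) (hx : x ∈ interior S) :
    StrictMono fun j => auxMu z b j x := by
  intro j j' hjj
  obtain ⟨a, ha⟩ := hsurj j'
  have hcont : Continuous fun t : ℝ => (1 : ℝ) • x + (-t) • (Pi.single a (1 : ℝ) : Fin n → ℝ) := by
    fun_prop
  have h0 : ∀ᶠ t in nhds (0 : ℝ), (1 : ℝ) • x + (-t) • (Pi.single a (1 : ℝ) : Fin n → ℝ) ∈ S := by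
    refine hcont.continuousAt.eventually_mem ?_
    simpa using mem_interior_iff_mem_nhds.1 hx
  obtain ⟨t, ht, htpos⟩ := ((h0.filter_mono nhdsWithin_le_nhds).and
    (self_mem_nhdsWithin : Set.Ioi (0 : ℝ) ∈ nhdsWithin 0 (Set.Ioi 0))).exists
  have htpos : 0 < t := htpos
  have hg := (hS ht).2.1 j j' hjj.le
  rw [auxMu_comb, auxMu_comb] at hg
  have e1 : auxMu z b j (Pi.single a (1 : ℝ)) = 0 := by
    unfold auxMu
    simp [Finset.sum_pi_single, ha, hjj.ne']
  have e2 : 0 < auxMu z b j' (Pi.single a (1 : ℝ)) := by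
    unfold auxMu
    refine div_pos ?_ (aux_dpos z hstrict b hsurj j')
    simp [Finset.sum_pi_single, ha]
  rw [e1] at hg
  have := mul_pos htpos e2
  show auxMu z b j x < auxMu z b j' x
  linarith

theorem aux_cle {n k k' : ℕ} (z : Finset (Fin n) → ℝ)
    (hsuper : ∀ I J : Finset (Fin n), z I + z J ≤ z (I ∪ J) + z (I ∩ J))
    (hstrict : ∀ I J : Finset (Fin n), I ⊂ J → z I < z J)
    (b : Fin n → Fin k) (hsurj : Function.Surjective b)
    (b' : Fin n → Fin k') (x : Fin n → ℝ)
    (hg : AuxGood z b x) (hg' : AuxGood z b' x) (i : Fin n) :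
    auxMu z b (b i) x ≤ auxMu z b' (b' i) x := by
  by_contra hlt
  push Not at hlt
  have hs0 := hg'.1 (b' i)
  have hC0 := hg.2.2 (b i)
  have hsp := aux_split b (b i) x
  have hd := aux_dpos z hstrict b hsurj (b i)
  have hmu : ∑ a ∈ univ.filter (fun a => b a = b i), x a = auxMu z b (b i) x *
      (z (univ.filter fun a => b a ≤ b i) - z (univ.filter fun a => b a < b i)) := by
    unfold auxMu
    rw [div_mul_cancel₀ _ hd.ne']
  have hD := hg'.2.2 (b' i)
  set t := auxMu z b (b i) x
  set s := auxMu z b' (b' i) x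
  set C := univ.filter fun a => b a < b i with hCdef
  set D := univ.filter fun a => b' a ≤ b' i with hDdef
  have h1 := hC0 (C ∪ D)
  have h2 := hD (C ∩ D)
  have h3 := hsuper C D
  have h4 : ∑ a ∈ C ∪ D, x a + ∑ a ∈ C ∩ D, x a = ∑ a ∈ C, x a + ∑ a ∈ D, x a :=
    Finset.sum_union_inter
  have h5 : z C < z (C ∪ D) := by
    refine hstrict _ _ ?_
    rw [Finset.ssubset_iff_of_subset Finset.subset_union_left]
    exact ⟨i, by simp [hDdef], by simp [hCdef]⟩
  have h6 := mul_le_mul_of_nonneg_left h3 hs0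
  have h7 := mul_pos (sub_pos.2 hlt) (sub_pos.2 h5)
  nlinarith

theorem aux_eq {n : ℕ} (π π' : OrderedPartition n) (b : Fin n → Fin π.k)
    (hb : ∀ i s, i ∈ π.blocks s ↔ b i = s) (b' : Fin n → Fin π'.k)
    (hb' : ∀ i s, i ∈ π'.blocks s ↔ b' i = s)
    (m : Fin π.k → ℝ) (hm : StrictMono m) (m' : Fin π'.k → ℝ) (hm' : StrictMono m')
    (h : ∀ i, m (b i) = m' (b' i)) : π = π' := by
  obtain ⟨k, B, hne, hdis, hcov⟩ := π
  obtain ⟨k', B', hne', hdis', hcov'⟩ := π'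
  dsimp only at *
  have hr : Set.range m = Set.range m' := by
    ext r
    constructor
    · rintro ⟨s, rfl⟩
      obtain ⟨i, hi⟩ := hne s
      exact ⟨b' i, by rw [← h, (hb i s).1 hi]⟩
    · rintro ⟨s, rfl⟩
      obtain ⟨i, hi⟩ := hne' s
      exact ⟨b i, by rw [h, (hb' i s).1 hi]⟩
  have hk : k = k' := by
    have h1 := Nat.card_range_of_injective hm.injective
    have h2 := Nat.card_range_of_injective hm'.injective
    rw [hr, h2] at h1
    simpa using h1.symm
  subst hk
  have hmm : m = m' := (StrictMono.range_inj hm hm').1 hr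
  subst hmm
  have : B = B' := by
    ext s i
    rw [hb, hb', hm.injective (h i)]
  subst this
  rfl

/-- Theorem: the full-dimensional projection
`Q(q) = { x : q·z_I ≤ x_I ≤ z_{[n]} − z_{[n]∖I} for all I }` of the `q`-lifting
is the union of the `π`-liftings `P^π(q)` over all ordered partitions `π` of
`[n]`, and distinct `π`-liftings have disjoint interiors. -/
theorem piLift_subdivision (n : ℕ)
    (z : Finset (Fin n) → ℝ) (hz0 : z ∅ = 0)
    (hsuper : ∀ I J : Finset (Fin n), z I + z J ≤ z (I ∪ J) + z (I ∩ J))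
    (hstrict : ∀ I J : Finset (Fin n), I ⊂ J → z I < z J)
    (q : ℝ) (hq0 : 0 ≤ q) (hq1 : q ≤ 1) :
    ({x : Fin n → ℝ | ∀ I : Finset (Fin n),
        q * z I ≤ ∑ i ∈ I, x i ∧ ∑ i ∈ I, x i ≤ z Finset.univ - z Iᶜ} =
      ⋃ π : OrderedPartition n, piLift π.k z π.blocks q) ∧
    (∀ π π' : OrderedPartition n, π ≠ π' →
      interior (piLift π.k z π.blocks q) ∩ interior (piLift π'.k z π'.blocks q) = ∅) := by
  have hsur : ∀ (π : OrderedPartition n) (b : Fin n → Fin π.k),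
      (∀ i s, i ∈ π.blocks s ↔ b i = s) → Function.Surjective b := by
    intro π b hb s
    obtain ⟨i, hi⟩ := π.nonempty_blocks s
    exact ⟨i, (hb i s).1 hi⟩
  constructor
  · apply Set.Subset.antisymm
    · intro x hx
      exact Set.mem_iUnion.2 (aux_sup z hz0 hsuper hstrict q hq0 hq1 x hx)
    · refine Set.iUnion_subset fun π => ?_
      obtain ⟨b, hb⟩ := aux_blk π
      exact aux_sub z hz0 hstrict q hq0 hq1 π.blocks b hb
  · intro π π' hne
    rw [Set.eq_empty_iff_forall_notMem]
    rintro x ⟨hx, hx'⟩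
    obtain ⟨b, hb⟩ := aux_blk π
    obtain ⟨b', hb'⟩ := aux_blk π'
    have hs := hsur π b hb
    have hs' := hsur π' b' hb'
    have hg := aux_good z hz0 hsuper hstrict q hq0 hq1 π.blocks b hb hs
    have hg' := aux_good z hz0 hsuper hstrict q hq0 hq1 π'.blocks b' hb' hs'
    refine hne (aux_eq π π' b hb b' hb' _ (aux_strict z hstrict b hs _ hg x hx) _
      (aux_strict z hstrict b' hs' _ hg' x hx') fun i => ?_)
    have g := hg (interior_subset hx)
    have g' := hg' (interior_subset hx')
    exact le_antisymm (aux_cle z hsuper hstrict b hs b' x g g' i)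
      (aux_cle z hsuper hstrict b' hs' b x g' g i)
end

section
/- Let c = (c_1,…,c_k) be a composition of size n. Then there is a polynomial f_c of degree n − k such that g_c(q) = (1−q)^k · f_c(q) for all real q, and f_c(1) = 1/k! (in particular f_c(1) ≠ 0). -/
open MeasureTheory

/-- Iterated integral defining the composition polynomial, peeling off the
outermost variable first (so the list argument is the reversed composition). -/
noncomputable def gAux : List ℕ → ℝ → ℝ → ℝ
  | [], _, _ => 1
  | a :: rest, q, u => ∫ t in q..u, t ^ (a - 1) * gAux rest q t

/-- The composition polynomial
`g_c(q) = ∫_q^1 ∫_q^{t_k} ⋯ ∫_q^{t_2} t_1^{c_1-1} ⋯ t_k^{c_k-1} dt_1 ⋯ dt_k`. -/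
noncomputable def gcomp (c : List ℕ) (q : ℝ) : ℝ := gAux c.reverse q 1

noncomputable def BB (k : ℕ) : ℕ → ℝ → ℝ → ℝ
  | 0, _, _ => 1 / ((k : ℝ) + 1)
  | m + 1, q, u => (1 / ((k : ℝ) + m + 2)) * (u ^ (m + 1) + ((m : ℝ) + 1) * (q * BB k m q u))

lemma BB_deriv (k m : ℕ) (q u : ℝ) :
    HasDerivAt (fun u => (u - q) ^ (k + 1) * BB k m q u) (u ^ m * (u - q) ^ k) u := by
  induction m with
  | zero =>
    have h := ((((hasDerivAt_id u).sub_const q).pow (k + 1)).mul_const (1 / ((k : ℝ) + 1)))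
    have : (k : ℝ) + 1 ≠ 0 := by positivity
    refine HasDerivAt.congr_deriv (HasDerivAt.congr_of_eventuallyEq h (Filter.Eventually.of_forall fun x => ?_)) ?_
    · simp [BB]
    · simp
      field_simp
  | succ m ih =>
    have h1 := (((hasDerivAt_id u).sub_const q).pow (k + 1)).mul ((hasDerivAt_id u).pow (m + 1))
    have h2 := (h1.add (ih.const_mul (((m : ℝ) + 1) * q))).const_mul (1 / ((k : ℝ) + m + 2))
    have : (k : ℝ) + m + 2 ≠ 0 := by positivity
    refine HasDerivAt.congr_deriv (HasDerivAt.congr_of_eventuallyEq h2 (Filter.Eventually.of_forall fun x => ?_)) ?_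
    · simp [BB]
      ring
    · simp
      field_simp
      ring

lemma BB_int (k m : ℕ) (q u : ℝ) :
    ∫ t in q..u, t ^ m * (t - q) ^ k = (u - q) ^ (k + 1) * BB k m q u := by
  rw [intervalIntegral.integral_eq_sub_of_hasDerivAt (fun x _ => BB_deriv k m q x)]
  · simp
  · exact Continuous.intervalIntegrable (by fun_prop) _ _

lemma BB_one (k m : ℕ) : BB k m 1 1 = 1 / ((k : ℝ) + 1) := by
  induction m with
  | zero => rfl
  | succ m ih =>
    have : (k : ℝ) + 1 ≠ 0 := by positivity
    have : (k : ℝ) + m + 2 ≠ 0 := by positivity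
    simp only [BB, ih]
    field_simp
    ring

lemma BB_pos (k m : ℕ) : 0 < BB k m 1 0 := by
  induction m with
  | zero => simp only [BB]; positivity
  | succ m ih =>
    simp only [BB]
    positivity

def NF (D : ℕ) (F : ℝ → ℝ → ℝ) : Prop :=
  ∃ h : ℕ → ℝ, (∀ i, 0 ≤ h i) ∧ ∀ q u, F q u = ∑ i ∈ Finset.range (D + 1), h i * (q ^ i * u ^ (D - i))

lemma NF.add {D : ℕ} {F G : ℝ → ℝ → ℝ} (hF : NF D F) (hG : NF D G) :
    NF D (fun q u => F q u + G q u) := by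
  obtain ⟨f, hf, hF⟩ := hF
  obtain ⟨g, hg, hG⟩ := hG
  refine ⟨fun i => f i + g i, fun i => add_nonneg (hf i) (hg i), fun q u => ?_⟩
  simp only [hF, hG, add_mul, Finset.sum_add_distrib]

lemma NF.smul {D : ℕ} {F : ℝ → ℝ → ℝ} (hF : NF D F) {c : ℝ} (hc : 0 ≤ c) :
    NF D (fun q u => c * F q u) := by
  obtain ⟨f, hf, hF⟩ := hF
  refine ⟨fun i => c * f i, fun i => mul_nonneg hc (hf i), fun q u => ?_⟩
  simp only [hF, Finset.mul_sum, mul_assoc]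

lemma NF.mulq {D : ℕ} {F : ℝ → ℝ → ℝ} (hF : NF D F) :
    NF (D + 1) (fun q u => q * F q u) := by
  obtain ⟨f, hf, hF⟩ := hF
  refine ⟨fun i => Nat.casesOn i 0 f, fun i => ?_, fun q u => ?_⟩
  · cases i
    · simp
    · exact hf _
  · rw [Finset.sum_range_succ']
    simp only [hF, Finset.mul_sum, Nat.add_sub_add_right]
    erw [zero_mul, add_zero]
    refine Finset.sum_congr rfl fun i _ => ?_
    ring

lemma NF.mulqpow {D : ℕ} {F : ℝ → ℝ → ℝ} (hF : NF D F) (i : ℕ) :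
    NF (D + i) (fun q u => q ^ i * F q u) := by
  induction i with
  | zero => simpa using hF
  | succ i ih =>
    have := ih.mulq
    have e : (fun q u : ℝ => q ^ (i + 1) * F q u) = fun q u => q * (q ^ i * F q u) := by
      funext q u
      ring
    rw [e]
    exact this

lemma NF.zero (D : ℕ) : NF D (fun _ _ => 0) := ⟨fun _ => 0, by simp, by simp⟩

lemma NF.sum {D : ℕ} (s : Finset ℕ) (F : ℕ → ℝ → ℝ → ℝ) (hF : ∀ i ∈ s, NF D (F i)) :
    NF D (fun q u => ∑ i ∈ s, F i q u) := by
  induction s using Finset.induction_on with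
  | empty => simpa using NF.zero D
  | insert a s ha ih =>
    simp only [Finset.sum_insert ha]
    exact (hF a (by simp)).add (ih fun i hi => hF i (by simp [hi]))

lemma NF.upow (D : ℕ) : NF D (fun _ u => u ^ D) := by
  refine ⟨fun i => if i = 0 then 1 else 0, fun i => by dsimp only; split_ifs <;> simp, fun q u => ?_⟩
  rw [Finset.sum_range_succ']
  simp

lemma BB_NF (k m : ℕ) : NF m (BB k m) := by
  induction m with
  | zero =>
    refine ⟨fun _ => 1 / ((k : ℝ) + 1), fun _ => by positivity, fun q u => ?_⟩
    simp [BB]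
  | succ m ih =>
    have := ((NF.upow (m + 1)).add ((ih.mulq).smul (c := (m : ℝ) + 1) (by positivity))).smul
      (c := 1 / ((k : ℝ) + m + 2)) (by positivity)
    exact this

lemma gAux_form (l : List ℕ) (hpos : ∀ a ∈ l, 0 < a) :
    ∃ (d : ℕ) (F : ℝ → ℝ → ℝ), d + l.length = l.sum ∧ NF d F ∧ 0 < F 1 0 ∧
      F 1 1 = 1 / (Nat.factorial l.length : ℝ) ∧
      ∀ q u, gAux l q u = (u - q) ^ l.length * F q u := by
  induction l with
  | nil =>
    refine ⟨0, fun _ _ => 1, by simp, by simpa using NF.upow 0, by simp, by simp, by simp [gAux]⟩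
  | cons a r ih =>
    obtain ⟨d, F, hd, ⟨h, hh, hF⟩, h0, h1, hg⟩ := ih fun x hx => hpos x (by simp [hx])
    have ha := hpos a (by simp)
    set k := r.length with hk
    have hB : ∀ i ∈ Finset.range (d + 1), NF (a - 1 + d)
        (fun q u => h i * (q ^ i * BB k (a - 1 + (d - i)) q u)) := by
      intro i hi
      have := ((BB_NF k (a - 1 + (d - i))).mulqpow i).smul (hh i)
      have e : a - 1 + (d - i) + i = a - 1 + d := by
        have := Finset.mem_range.1 hi
        omega
      rwa [e] at this
    refine ⟨a - 1 + d, fun q u => ∑ i ∈ Finset.range (d + 1),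
      h i * (q ^ i * BB k (a - 1 + (d - i)) q u), ?_, NF.sum _ _ hB, ?_, ?_, ?_⟩
    · simp only [List.length_cons, List.sum_cons]
      omega
    · rw [hF, Finset.sum_range_succ, Finset.sum_eq_zero] at h0
      · simp only [one_pow, one_mul]
        refine Finset.sum_pos' (fun i _ => mul_nonneg (hh i) (BB_pos _ _).le)
          ⟨d, by simp, mul_pos (by simpa using h0) (BB_pos _ _)⟩
      · intro i hi
        have := Finset.mem_range.1 hi
        have : d - i ≠ 0 := by omega
        simp [this]
    · rw [hF] at h1
      simp only [one_pow, mul_one] at h1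
      simp only [one_pow, one_mul, BB_one, ← Finset.sum_mul, h1, List.length_cons]
      rw [← hk, Nat.factorial_succ]
      push_cast
      field_simp
    · intro q u
      simp only [gAux, List.length_cons, ← hk]
      rw [Finset.mul_sum]
      have : ∀ t : ℝ, t ^ (a - 1) * gAux r q t = ∑ i ∈ Finset.range (d + 1),
          (h i * q ^ i) * (t ^ (a - 1 + (d - i)) * (t - q) ^ k) := by
        intro t
        rw [hg, hF, Finset.mul_sum, Finset.mul_sum]
        refine Finset.sum_congr rfl fun i _ => ?_
        rw [pow_add]
        ring
      simp only [this]
      rw [intervalIntegral.integral_finsetSum]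
      · refine Finset.sum_congr rfl fun i _ => ?_
        rw [intervalIntegral.integral_const_mul, BB_int]
        ring
      · intro i _
        exact Continuous.intervalIntegrable (by fun_prop) _ _

/-- Theorem: for a composition `c` of size `n` into `k` parts, there is a polynomial
`f_c` of degree `n − k` with `g_c(q) = (1−q)^k · f_c(q)` for all `q`,
`f_c(1) = 1/k!`, and in particular `f_c(1) ≠ 0`. -/
theorem composition_polynomial_reduced (c : List ℕ) (hpos : ∀ a ∈ c, 0 < a) :
    ∃ f : Polynomial ℝ,
      f.natDegree = c.sum - c.length ∧
      (∀ q : ℝ, gcomp c q = (1 - q) ^ c.length * f.eval q) ∧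
      f.eval 1 = 1 / (Nat.factorial c.length : ℝ) ∧
      f.eval 1 ≠ 0 := by
  obtain ⟨d, F, hd, ⟨h, hh, hF⟩, h0, h1, hg⟩ := gAux_form c.reverse (by simpa using hpos)
  simp only [List.length_reverse, List.sum_reverse] at hd h1 hg
  have hev : ∀ q, (∑ i ∈ Finset.range (d + 1), Polynomial.C (h i) * Polynomial.X ^ i).eval q
      = F q 1 := by
    intro q
    rw [hF, Polynomial.eval_finsetSum]
    simp
  have hdpos : 0 < h d := by
    rw [hF, Finset.sum_range_succ, Finset.sum_eq_zero] at h0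
    · simpa using h0
    · intro i hi
      have := Finset.mem_range.1 hi
      have : d - i ≠ 0 := by omega
      simp [this]
  refine ⟨∑ i ∈ Finset.range (d + 1), Polynomial.C (h i) * Polynomial.X ^ i, ?_, ?_, ?_, ?_⟩
  · have e : c.sum - c.length = d := by omega
    rw [e]
    apply Polynomial.natDegree_eq_of_le_of_coeff_ne_zero
    · refine Polynomial.natDegree_sum_le_of_forall_le _ _ fun i hi => ?_
      have := Finset.mem_range.1 hi
      exact (Polynomial.natDegree_C_mul_X_pow_le _ _).trans (by omega)
    · rw [Polynomial.finsetSum_coeff]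
      simp [Polynomial.coeff_X_pow, hdpos.ne']
  · intro q
    rw [hev, gcomp, hg]
  · rw [hev, h1]
  · rw [hev, h1]
    positivity
end

section
/- Let c = (c_1,…,c_k) be a composition of size n and let P_c be the associated poset on n+1 elements with minimum-chain element p_0. For 1 ≤ j ≤ n+1, let N_j be the number of linear extensions of P_c in which p_0 has height j, i.e. the number of order-preserving bijections σ : P_c → {1,…,n+1} with σ(p_0) = j. Then for every real q, g_c(q) = ((c_1−1)!⋯(c_k−1)!/n!) · Σ_{i=0}^n N_{i+1} · C(n,i) · q^i (1−q)^{n−i}, and moreover the sequence is log-concave: N_j² ≥ N_{j−1}·N_{j+1} for all 2 ≤ j ≤ n. -/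
open MeasureTheory

/-- For the composition `c` with parts `c_i = d i + 1`, the elements of the
poset `P_c` other than `p_0`: the element `⟨i, d i⟩` is `p_i`, and `⟨i, r⟩`
with `r < d i` are the extra chain of `c_i − 1` elements below `p_i`. -/
def posetLe {k : ℕ} (d : Fin k → ℕ) (x y : (i : Fin k) × Fin (d i + 1)) : Prop :=
  (x.1 = y.1 ∧ (x.2 : ℕ) ≤ (y.2 : ℕ)) ∨ (x.1 < y.1 ∧ (y.2 : ℕ) = d y.1)

/-- The order relation of the poset `P_c` on `n + 1` elements: `none` is the
minimum-chain element `p_0` (below `p_1, …, p_k` and nothing else), and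
`some` elements are ordered by `posetLe`. -/
def posetLeFull {k : ℕ} (d : Fin k → ℕ) :
    Option ((i : Fin k) × Fin (d i + 1)) → Option ((i : Fin k) × Fin (d i + 1)) → Prop
  | none, none => True
  | none, some b => (b.2 : ℕ) = d b.1
  | some _, none => False
  | some a, some b => posetLe d a b

/-- The number of linear extensions of `P_c` (order-preserving bijections
`σ : P_c → {1, …, n+1}`, realized as equivalences with `Fin (n+1)`) in which
`p_0` has height `j`, i.e. `σ(p_0) = j`. -/
noncomputable def numExt {k : ℕ} (d : Fin k → ℕ) (j : ℕ) : ℕ :=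
  Nat.card {σ : Option ((i : Fin k) × Fin (d i + 1)) ≃ Fin (∑ i, (d i + 1) + 1) //
    (∀ a b, posetLeFull d a b → σ a ≤ σ b) ∧ (σ none : ℕ) + 1 = j}


noncomputable def extCount {α : Type} (R : α → α → Prop) (x : α) (N j : ℕ) : ℕ :=
  Nat.card {σ : α ≃ Fin N // (∀ a b, R a b → σ a ≤ σ b) ∧ (σ x : ℕ) = j}

theorem extCount_congr {α β : Type} (R : α → α → Prop) (S : β → β → Prop) (x : α) (y : β)
    (e : α ≃ β) (hR : ∀ a b, a ≠ b → (R a b ↔ S (e a) (e b))) (hx : e x = y) (N j : ℕ) :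
    extCount R x N j = extCount S y N j := by
  unfold extCount
  apply Nat.card_congr
  refine Equiv.subtypeEquiv (Equiv.equivCongr e (Equiv.refl _)) ?_
  intro σ
  subst hx
  constructor
  · rintro ⟨h1, h2⟩
    refine ⟨?_, by simpa using h2⟩
    intro a b hab
    by_cases h : a = b
    · subst h; exact le_rfl
    · simp only [Equiv.equivCongr_apply_apply, Equiv.refl_apply]
      apply h1
      rw [hR _ _ (by simpa using h)]
      simpa using hab
  · rintro ⟨h1, h2⟩
    refine ⟨?_, by simpa using h2⟩
    intro a b hab
    by_cases h : a = b
    · subst h; exact le_rfl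
    · have := h1 (e a) (e b) ((hR _ _ h).1 hab)
      simpa using this

theorem extCount_zero {α : Type} (R : α → α → Prop) (x : α) (N j : ℕ) (h : N ≤ j) :
    extCount R x N j = 0 := by
  unfold extCount
  have : IsEmpty {σ : α ≃ Fin N // (∀ a b, R a b → σ a ≤ σ b) ∧ (σ x : ℕ) = j} := by
    constructor
    rintro ⟨σ, _, h2⟩
    have := (σ x).2
    omega
  simp

theorem extCount_unique {α : Type} [Unique α] (R : α → α → Prop) (x : α) :
    extCount R x 1 0 = 1 := by
  unfold extCount
  rw [Nat.card_eq_one_iff_unique]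
  refine ⟨⟨?_⟩, ⟨⟨Equiv.ofUnique α (Fin 1), ?_⟩⟩⟩
  · rintro ⟨a, _⟩ ⟨b, _⟩
    apply Subtype.ext
    exact Subsingleton.elim a b
  · refine ⟨fun a b _ => le_of_eq (Subsingleton.elim _ _), by simp⟩

def relFree {α : Type} (R : α → α → Prop) : Option α → Option α → Prop
  | some a, some b => R a b
  | _, _ => False

def relTop {α : Type} (R : α → α → Prop) : Option α → Option α → Prop
  | some a, some b => R a b
  | some _, none => True
  | none, _ => False

def relAnti {α : Type} (R : α → α → Prop) (r : ℕ) : α ⊕ Fin r → α ⊕ Fin r → Prop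
  | .inl a, .inl b => R a b
  | _, _ => False

def relChain {α : Type} (R : α → α → Prop) (r : ℕ) : α ⊕ Fin r → α ⊕ Fin r → Prop
  | .inl a, .inl b => R a b
  | .inr a, .inr b => a ≤ b
  | _, _ => False

/-- insertion of a new element -/
def insEquiv (α : Type) (N : ℕ) : (Option α ≃ Fin (N+1)) ≃ Fin (N+1) × (α ≃ Fin N) where
  toFun σ := (σ none, Equiv.removeNone (σ.trans (finSuccEquiv' (σ none))))
  invFun p := (Equiv.optionCongr p.2).trans (finSuccEquiv' p.1).symm
  left_inv σ := by
    have h : (σ.trans (finSuccEquiv' (σ none))) none = none := by simp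
    ext a
    cases a with
    | none => simp
    | some a =>
      have h3 : (σ.trans (finSuccEquiv' (σ none))) (some a) ≠ none := by
        intro h4
        have := (σ.trans (finSuccEquiv' (σ none))).injective (h4.trans h.symm)
        simp at this
      have h2 := Equiv.removeNone_some (σ.trans (finSuccEquiv' (σ none))) (x := a)
        (Option.ne_none_iff_exists'.1 h3)
      simp only [Equiv.trans_apply, Equiv.optionCongr_apply, Option.map_some]
      rw [h2]
      simp
  right_inv p := by
    obtain ⟨p, σ⟩ := p
    have h : ((Equiv.optionCongr σ).trans (finSuccEquiv' p).symm) none = p := by simp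
    refine Prod.ext (by simp) ?_
    simp only [h]
    rw [Equiv.trans_assoc, Equiv.symm_trans_self, Equiv.trans_refl]
    exact Equiv.removeNone_optionCongr σ

theorem insEquiv_symm_none {α : Type} {N : ℕ} (p : Fin (N+1)) (σ : α ≃ Fin N) :
    (insEquiv α N).symm (p, σ) none = p := by simp [insEquiv]

theorem insEquiv_symm_some {α : Type} {N : ℕ} (p : Fin (N+1)) (σ : α ≃ Fin N) (a : α) :
    (insEquiv α N).symm (p, σ) (some a) = p.succAbove (σ a) := by simp [insEquiv]

theorem extCount_top {α : Type} (R : α → α → Prop) (x : α) (N j : ℕ) :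
    extCount (relTop R) (some x) (N+1) j = extCount R x N j := by
  unfold extCount
  symm
  refine Nat.card_eq_of_bijective (fun σ => ⟨(insEquiv α N).symm (Fin.last N, σ.1), ?_, ?_⟩) ⟨?_, ?_⟩
  · rintro (_ | a) (_ | b) h
    · exact le_rfl
    · exact h.elim
    · rw [insEquiv_symm_none]; exact Fin.le_last _
    · rw [insEquiv_symm_some, insEquiv_symm_some, Fin.succAbove_le_succAbove_iff]
      exact σ.2.1 a b h
  · rw [insEquiv_symm_some, Fin.succAbove_last]
    exact σ.2.2
  · intro σ τ h
    simpa [Subtype.ext_iff] using h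
  · rintro ⟨σ, h1, h2⟩
    obtain ⟨⟨p, τ⟩, rfl⟩ := (insEquiv α N).symm.surjective σ
    have hp : p = Fin.last N := by
      obtain ⟨y, hy⟩ := ((insEquiv α N).symm (p, τ)).surjective (Fin.last N)
      cases y with
      | none => rwa [insEquiv_symm_none] at hy
      | some a =>
        have := h1 (some a) none trivial
        rw [hy, insEquiv_symm_none] at this
        exact le_antisymm (Fin.le_last _) this
    subst hp
    refine ⟨⟨τ, ?_, ?_⟩, rfl⟩
    · intro a b h
      have := h1 (some a) (some b) h
      rwa [insEquiv_symm_some, insEquiv_symm_some, Fin.succAbove_le_succAbove_iff] at this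
    · rwa [insEquiv_symm_some, Fin.succAbove_last] at h2

def stepSeq (N : ℕ) (a : ℕ → ℕ) (j : ℕ) : ℕ := j * a (j-1) + (N - j) * a j

theorem extCount_free {α : Type} [Finite α] (R : α → α → Prop) (x : α) (N j : ℕ) :
    extCount (relFree R) (some x) (N+1) j = stepSeq N (extCount R x N) j := by
  have e : {σ : Option α ≃ Fin (N+1) //
      (∀ a b, relFree R a b → σ a ≤ σ b) ∧ (σ (some x) : ℕ) = j} ≃
      Σ p : Fin (N+1), {σ : α ≃ Fin N // (∀ a b, R a b → σ a ≤ σ b) ∧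
        (p.succAbove (σ x) : ℕ) = j} := by
    refine Equiv.trans (Equiv.subtypeEquiv (q := fun z : Fin (N+1) × (α ≃ Fin N) =>
      (∀ a b, R a b → z.2 a ≤ z.2 b) ∧ (z.1.succAbove (z.2 x) : ℕ) = j) (insEquiv α N) ?_) ?_
    · intro σ
      obtain ⟨⟨p, τ⟩, rfl⟩ := (insEquiv α N).symm.surjective σ
      rw [Equiv.apply_symm_apply, insEquiv_symm_some]
      refine and_congr_left fun _ => ⟨?_, ?_⟩
      · intro h a b hab
        have := h (some a) (some b) hab
        rwa [insEquiv_symm_some, insEquiv_symm_some, Fin.succAbove_le_succAbove_iff] at this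
      · rintro h (_ | a) (_ | b) hab
        · exact hab.elim
        · exact hab.elim
        · exact hab.elim
        · rw [insEquiv_symm_some, insEquiv_symm_some, Fin.succAbove_le_succAbove_iff]
          exact h a b hab
    · exact {
        toFun := fun z => ⟨z.1.1, z.1.2, z.2⟩
        invFun := fun z => ⟨(z.1, z.2.1), z.2.2⟩
        left_inv := fun _ => rfl
        right_inv := fun _ => rfl }
  have hc : ∀ p : Fin (N+1), Nat.card {σ : α ≃ Fin N // (∀ a b, R a b → σ a ≤ σ b) ∧
        (p.succAbove (σ x) : ℕ) = j} =
        if (p:ℕ) < j then extCount R x N (j-1) else if j < p then extCount R x N j else 0 := by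
    intro p
    have key : ∀ y : Fin N, (p.succAbove y : ℕ) = if (y:ℕ) < p then (y:ℕ) else y + 1 := by
      intro y
      rw [Fin.succAbove]
      simp only [Fin.lt_def, Fin.val_castSucc]
      split_ifs <;> simp
    split_ifs with h1 h2
    · unfold extCount
      refine Nat.card_congr (Equiv.subtypeEquivRight fun σ => and_congr_right fun _ => ?_)
      rw [key]; split_ifs <;> omega
    · unfold extCount
      refine Nat.card_congr (Equiv.subtypeEquivRight fun σ => and_congr_right fun _ => ?_)
      rw [key]; split_ifs <;> omega
    · have : IsEmpty {σ : α ≃ Fin N // (∀ a b, R a b → σ a ≤ σ b) ∧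
        (p.succAbove (σ x) : ℕ) = j} := by
        constructor
        rintro ⟨σ, _, h⟩
        rw [key] at h
        split_ifs at h <;> omega
      simp
  unfold extCount
  rw [Nat.card_congr e, Nat.card_sigma]
  simp only [hc]
  rw [Fin.sum_univ_eq_sum_range (fun p => if p < j then extCount R x N (j-1) else
    if j < p then extCount R x N j else 0) (N+1)]
  unfold stepSeq
  change _ = j * extCount R x N (j-1) + (N-j) * extCount R x N j
  by_cases hj : j ≤ N
  · obtain ⟨m, rfl⟩ := Nat.exists_eq_add_of_le hj
    rw [show j + m + 1 = j + (m + 1) by ring, Finset.sum_range_add, Finset.sum_range_succ']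
    rw [Finset.sum_congr rfl (g := fun _ => extCount R x (j+m) (j-1))
      (fun i hi => by simp [Finset.mem_range.1 hi])]
    rw [Finset.sum_congr rfl (g := fun _ => extCount R x (j+m) j) (s₁ := Finset.range m)
      (fun i hi => by rw [if_neg (by omega), if_pos (by omega)])]
    simp
  · rw [extCount_zero R x N (j-1) (by omega), extCount_zero R x N j (by omega)]
    simp

theorem extCount_chain {α : Type} [Finite α] (R : α → α → Prop) (x : α) (r N j : ℕ) :
    r.factorial * extCount (relChain R r) (.inl x) N j = extCount (relAnti R r) (.inl x) N j := by
  have hf : r.factorial = Nat.card (Equiv.Perm (Fin r)) := by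
    rw [Nat.card_perm]; simp
  unfold extCount
  rw [hf, ← Nat.card_prod]
  refine Nat.card_eq_of_bijective
    (fun z => ⟨(Equiv.sumCongr (Equiv.refl α) z.1).trans z.2.1, ?_, ?_⟩) ⟨?_, ?_⟩
  · rintro (a | a) (b | b) h
    · exact z.2.2.1 (.inl a) (.inl b) h
    · exact h.elim
    · exact h.elim
    · exact h.elim
  · exact z.2.2.2
  · rintro ⟨τ, σ, h1, h2⟩ ⟨τ', σ', h1', h2'⟩ h
    simp only [Subtype.mk.injEq] at h
    have hl : ∀ a, σ (.inl a) = σ' (.inl a) := fun a => by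
      simpa using DFunLike.congr_fun h (.inl a)
    have hr : ∀ a, σ (.inr (τ a)) = σ' (.inr (τ' a)) := fun a => by
      simpa using DFunLike.congr_fun h (.inr a)
    have m1 : StrictMono (fun i => σ (.inr i)) :=
      Monotone.strictMono_of_injective (fun a b hab => h1 (.inr a) (.inr b) hab)
        (σ.injective.comp Sum.inr_injective)
    have m2 : StrictMono (fun i => σ' (.inr i)) :=
      Monotone.strictMono_of_injective (fun a b hab => h1' (.inr a) (.inr b) hab)
        (σ'.injective.comp Sum.inr_injective)
    have hrange : Set.range (fun i => σ (.inr i)) = Set.range (fun i => σ' (.inr i)) := by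
      ext y
      constructor
      · rintro ⟨i, rfl⟩
        refine ⟨τ' (τ.symm i), ?_⟩
        simp [← hr]
      · rintro ⟨i, rfl⟩
        refine ⟨τ (τ'.symm i), ?_⟩
        simp [hr]
    have hh := (StrictMono.range_inj m1 m2).1 hrange
    have hσ : σ = σ' := by
      ext y
      cases y with
      | inl a => rw [hl]
      | inr i => rw [congrFun hh i]
    subst hσ
    have hτ : τ = τ' := by
      ext i
      have := σ.injective (hr i)
      rw [Sum.inr.inj this]
    subst hτ
    rfl
  · rintro ⟨σ, h1, h2⟩
    let f : Fin r → Fin N := fun i => σ (.inr i)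
    refine ⟨⟨(Tuple.sort f).symm, (Equiv.sumCongr (Equiv.refl α) (Tuple.sort f)).trans σ, ?_, ?_⟩, ?_⟩
    · rintro (a | a) (b | b) h
      · exact h1 (.inl a) (.inl b) h
      · exact h.elim
      · exact h.elim
      · exact Tuple.monotone_sort f h
    · exact h2
    · apply Subtype.ext
      ext y
      cases y <;> simp

def iterSeq (N : ℕ) (a : ℕ → ℕ) : ℕ → (ℕ → ℕ)
  | 0 => a
  | r+1 => stepSeq (N + r) (iterSeq N a r)

theorem extCount_anti {α : Type} [Finite α] (R : α → α → Prop) (x : α) (r N : ℕ) :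
    extCount (relAnti R r) (.inl x) (N+r) = iterSeq N (extCount R x N) r := by
  induction r with
  | zero =>
    funext j
    symm
    refine extCount_congr _ _ _ _ (Equiv.sumEmpty α (Fin 0)).symm ?_ rfl _ _
    intro a b _
    rfl
  | succ r ih =>
    funext j
    rw [iterSeq, ← ih, ← extCount_free]
    symm
    let g : Option (α ⊕ Fin r) → α ⊕ Fin (r+1)
      | none => .inr (Fin.last r)
      | some (.inl a) => .inl a
      | some (.inr i) => .inr i.castSucc
    have hg : Function.Bijective g := by
      constructor
      · rintro (_ | a | a) (_ | b | b) h
        · rfl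
        · cases h
        · exact absurd (Sum.inr.inj h).symm (Fin.castSucc_lt_last b).ne
        · cases h
        · rw [Sum.inl.inj h]
        · cases h
        · exact absurd (Sum.inr.inj h) (Fin.castSucc_lt_last a).ne
        · cases h
        · rw [Fin.castSucc_injective _ (Sum.inr.inj h)]
      · rintro (a | i)
        · exact ⟨some (.inl a), rfl⟩
        · induction i using Fin.lastCases with
          | last => exact ⟨none, rfl⟩
          | cast i => exact ⟨some (.inr i), rfl⟩
    refine extCount_congr _ _ _ _ (Equiv.ofBijective g hg) ?_ rfl _ _
    rintro (_ | a | a) (_ | b | b) _ <;> rfl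

theorem numExt_eq {k : ℕ} (d : Fin k → ℕ) (j : ℕ) :
    numExt d (j+1) = extCount (posetLeFull d) none (∑ i, (d i + 1) + 1) j := by
  unfold numExt extCount
  simp only [Nat.add_right_cancel_iff]

theorem numExt_rec {k : ℕ} (d : Fin (k+1) → ℕ) :
    (fun j => (d (Fin.last k)).factorial * numExt d (j+1)) =
      iterSeq (∑ i : Fin k, (d i.castSucc + 1) + 1)
        (fun j => numExt (fun i : Fin k => d i.castSucc) (j+1)) (d (Fin.last k)) := by
  have h1 : (fun j => numExt (fun i : Fin k => d i.castSucc) (j+1)) =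
    extCount (posetLeFull (fun i : Fin k => d i.castSucc)) none
      (∑ i : Fin k, (d i.castSucc + 1) + 1) := funext fun j => numExt_eq _ j
  rw [h1, ← extCount_anti]
  funext j
  rw [← extCount_chain, ← extCount_top, numExt_eq, Fin.sum_univ_castSucc]
  congr 1
  rw [show ∑ i : Fin k, (d i.castSucc + 1) + (d (Fin.last k) + 1) + 1 =
    ∑ i : Fin k, (d i.castSucc + 1) + 1 + d (Fin.last k) + 1 by ring]
  symm
  let g : Option (Option ((i : Fin k) × Fin (d i.castSucc + 1)) ⊕ Fin (d (Fin.last k))) →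
      Option ((i : Fin (k+1)) × Fin (d i + 1))
    | none => some ⟨Fin.last k, Fin.last _⟩
    | some (.inl none) => none
    | some (.inl (some x)) => some ⟨x.1.castSucc, x.2⟩
    | some (.inr i) => some ⟨Fin.last k, i.castSucc⟩
  have hg : Function.Bijective g := by
    constructor
    · rintro (_ | (_ | ⟨i, a⟩) | a) (_ | (_ | ⟨i', b⟩) | b) h
      all_goals simp only [g, Option.some.injEq, Sigma.mk.injEq, reduceCtorEq] at h
      all_goals first
        | rfl
        | skip
      all_goals obtain ⟨h1, h2⟩ := h
      · exact absurd h1.symm (Fin.castSucc_lt_last _).ne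
      · exact absurd (eq_of_heq h2).symm (Fin.castSucc_lt_last _).ne
      · exact absurd h1 (Fin.castSucc_lt_last _).ne
      · obtain rfl := Fin.castSucc_injective _ h1
        rw [eq_of_heq h2]
      · exact absurd h1 (Fin.castSucc_lt_last _).ne
      · exact absurd (eq_of_heq h2) (Fin.castSucc_lt_last _).ne
      · exact absurd h1.symm (Fin.castSucc_lt_last _).ne
      · rw [Fin.castSucc_injective _ (eq_of_heq h2)]
    · rintro (_ | ⟨i, a⟩)
      · exact ⟨some (.inl none), rfl⟩
      · induction i using Fin.lastCases with
        | last =>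
          induction a using Fin.lastCases with
          | last => exact ⟨none, rfl⟩
          | cast a => exact ⟨some (.inr a), rfl⟩
        | cast i => exact ⟨some (.inl (some ⟨i, a⟩)), rfl⟩
  refine extCount_congr _ _ _ _ (Equiv.ofBijective g hg) ?_ rfl _ _
  have hl : ∀ i : Fin k, ¬ (Fin.last k = i.castSucc) :=
    fun i h => (Fin.castSucc_lt_last i).ne h.symm
  have hl' : ∀ i : Fin k, ¬ (i.castSucc = Fin.last k) :=
    fun i h => (Fin.castSucc_lt_last i).ne h
  have hl2 : ∀ i : Fin k, ¬ (Fin.last k < i.castSucc) :=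
    fun i h => absurd h (Fin.castSucc_lt_last i).not_gt
  rintro (_ | (_ | ⟨i, a⟩) | a) (_ | (_ | ⟨i', b⟩) | b) hne
  all_goals simp only [ne_eq, not_true_eq_false, reduceCtorEq, not_false_eq_true] at hne
  all_goals
    simp [g, relTop, relChain, posetLeFull, posetLe, hl, hl', hl2, Fin.castSucc_lt_last]
  all_goals first
    | omega
    | skip

/-! ### log-concavity -/

def LC (a : ℕ → ℕ) : Prop :=
  (∀ i, a i * a (i+2) ≤ a (i+1)^2) ∧ (∀ i, 0 < a (i+1) → 0 < a i)

theorem LC_three {a : ℕ → ℕ} (h : LC a) (i : ℕ) : a i * a (i+3) ≤ a (i+1) * a (i+2) := by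
  obtain ⟨h1, h2⟩ := h
  rcases Nat.eq_zero_or_pos (a (i+3)) with h0 | h0
  · simp [h0]
  · have hz := h2 _ h0
    have hy := h2 _ hz
    have e1 := h1 i
    have e2 := h1 (i+1)
    have e3 := Nat.mul_le_mul e1 e2
    refine Nat.le_of_mul_le_mul_right ?_ (Nat.mul_pos hy hz)
    calc _ = a i * a (i+2) * (a (i+1) * a (i+1+2)) := by
            rw [show i+1+2 = i+3 by ring]; ring
      _ ≤ _ := e3
      _ = _ := by rw [show i+1+1 = i+2 by ring]; ring

theorem LC_step {a : ℕ → ℕ} {N : ℕ} (h : LC a) (h0 : ∀ i, N ≤ i → a i = 0) :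
    LC (stepSeq N a) ∧ ∀ i, N + 1 ≤ i → stepSeq N a i = 0 := by
  have hz : ∀ i, N + 1 ≤ i → stepSeq N a i = 0 := by
    intro i hi
    simp [stepSeq, h0 (i-1) (by omega), h0 i (by omega)]
  refine ⟨⟨?_, ?_⟩, hz⟩
  · intro i
    by_cases hi : N < i + 2
    · rw [hz (i+2) (by omega)]; simp
    · obtain ⟨s, rfl⟩ := Nat.exists_eq_add_of_le (not_lt.1 hi)
      have e1 : i + 2 + s - i = s + 2 := by omega
      have e2 : i + 2 + s - (i+1) = s + 1 := by omega
      have e3 : i + 2 + s - (i+2) = s := by omega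
      have f2 : i + 1 - 1 = i := by omega
      have f3 : i + 2 - 1 = i + 1 := by omega
      unfold stepSeq
      rw [e1, e2, e3, f2, f3]
      have hyz := h.1 i
      rcases i with _ | i
      · simp only [zero_add, zero_mul, one_mul] at *
        zify at *
        nlinarith [sq_nonneg ((a 0 : ℤ) - a 1), mul_le_mul_of_nonneg_left hyz (show (0:ℤ) ≤ s*(s+2) by positivity)]
      · have g1 := h.1 i
        have g3 := LC_three h i
        rw [show i + 1 - 1 = i by omega]
        rw [show i + 1 + 2 = i + 3 by ring, show i + 1 + 1 = i + 2 by ring] at *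
        generalize a i = x at *
        generalize a (i+1) = y at *
        generalize a (i+2) = z at *
        generalize a (i+3) = w at *
        zify at *
        have p1 := mul_le_mul_of_nonneg_left g1 (show (0:ℤ) ≤ (i+1)*(i+3) by positivity)
        have p2 := mul_le_mul_of_nonneg_left hyz (show (0:ℤ) ≤ s*(s+2) by positivity)
        have p3 := mul_le_mul_of_nonneg_left g3 (show (0:ℤ) ≤ (i+1)*s by positivity)
        nlinarith [sq_nonneg ((y : ℤ) - z)]
  · intro i hi
    unfold stepSeq at *
    rw [show i + 1 - 1 = i by omega] at hi
    by_contra hc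
    have hc' : i * a (i-1) + (N-i) * a i = 0 := by omega
    have hN : ¬ N ≤ i := by
      intro hN
      rw [h0 i hN, h0 (i+1) (by omega)] at hi
      simp at hi
    have ha : a i = 0 := by
      have : (N - i) * a i = 0 := by omega
      rcases Nat.mul_eq_zero.1 this with h' | h'
      · omega
      · exact h'
    have ha1 : a (i+1) = 0 := by
      by_contra h'
      have := h.2 i (Nat.pos_of_ne_zero h')
      omega
    rw [ha, ha1] at hi
    simp at hi

theorem LC_iter {a : ℕ → ℕ} {N : ℕ} (h : LC a) (h0 : ∀ i, N ≤ i → a i = 0) (r : ℕ) :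
    LC (iterSeq N a r) ∧ ∀ i, N + r ≤ i → iterSeq N a r i = 0 := by
  induction r with
  | zero => exact ⟨h, h0⟩
  | succ r ih => exact LC_step ih.1 ih.2

theorem LC_of_mul {a : ℕ → ℕ} {c : ℕ} (hc : 0 < c) (h : LC (fun j => c * a j)) : LC a := by
  refine ⟨fun i => ?_, fun i hi => ?_⟩
  · have := h.1 i
    refine Nat.le_of_mul_le_mul_left (c := c * c) ?_ (Nat.mul_pos hc hc)
    nlinarith
  · exact Nat.pos_of_mul_pos_left (h.2 i (Nat.mul_pos hc hi))

theorem numExt_zero {k : ℕ} (d : Fin k → ℕ) (j : ℕ) (h : ∑ i, (d i + 1) + 1 ≤ j) :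
    numExt d (j+1) = 0 := by
  rw [numExt_eq]; exact extCount_zero _ _ _ _ h

theorem numExt_base (d : Fin 0 → ℕ) : numExt d 1 = 1 := by
  have := numExt_eq d 0
  rw [show 0 + 1 = 1 from rfl] at this
  rw [this]
  simp only [Finset.univ_eq_empty, Finset.sum_empty, zero_add]
  exact extCount_unique _ _

theorem numExt_LC {k : ℕ} (d : Fin k → ℕ) : LC (fun j => numExt d (j+1)) := by
  induction k with
  | zero =>
    have hz : ∀ j, numExt d (j+1+1) = 0 := fun j => numExt_zero d (j+1) (by simp)
    refine ⟨fun i => ?_, fun i hi => ?_⟩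
    · have := hz (i+1)
      simp only [this]
      simp
    · simp only [hz i] at hi
      simp at hi
  | succ k ih =>
    apply LC_of_mul (Nat.factorial_pos (d (Fin.last k)))
    have := numExt_rec d
    rw [this]
    exact (LC_iter (ih _) (fun i hi => numExt_zero _ i hi) _).1

/-! ### Bernstein expansions -/

noncomputable def bern (m : ℕ) (a : ℕ → ℕ) (q t : ℝ) : ℝ :=
  ∑ i ∈ Finset.range (m+1), (a i : ℝ) * (m.choose i : ℝ) * q ^ i * (t - q) ^ (m - i)

theorem bern_step (m : ℕ) (a : ℕ → ℕ) (q t : ℝ) :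
    ((m:ℝ)+1) * (t * bern m a q t) = bern (m+1) (stepSeq (m+1) a) q t := by
  have key1 : ∀ i ∈ Finset.range (m+1),
      ((m:ℝ)+1) * (t * ((a i : ℝ) * (m.choose i : ℝ) * q ^ i * (t - q) ^ (m - i))) =
      ((i:ℝ)+1) * a i * ((m+1).choose (i+1) : ℝ) * q^(i+1) * (t-q)^(m+1-(i+1)) +
      ((m+1-i : ℕ):ℝ) * a i * ((m+1).choose i : ℝ) * q^i * (t-q)^(m+1-i) := by
    intro i hi
    have hi' : i ≤ m := by simpa [Nat.lt_succ_iff] using hi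
    have c1 : ((m:ℝ)+1) * (m.choose i : ℝ) = ((m+1).choose (i+1) : ℝ) * ((i:ℝ)+1) := by
      exact_mod_cast Nat.add_one_mul_choose_eq m i
    have c2 : ((m:ℝ)+1) * (m.choose i : ℝ) = ((m+1).choose i : ℝ) * ((m+1-i : ℕ):ℝ) := by
      have := Nat.choose_mul_succ_eq m i
      rw [mul_comm]
      exact_mod_cast this
    rw [show m + 1 - (i+1) = m - i by omega, show m + 1 - i = (m - i) + 1 by omega] at *
    calc _ = (((m:ℝ)+1) * (m.choose i : ℝ)) * a i * q^(i+1) * (t-q)^(m-i) +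
          (((m:ℝ)+1) * (m.choose i : ℝ)) * a i * q^i * (t-q)^(m-i+1) := by ring
      _ = _ := by
        nth_rewrite 1 [c1]
        rw [c2]
        ring
  unfold bern
  rw [Finset.mul_sum, Finset.mul_sum, Finset.sum_congr rfl key1, Finset.sum_add_distrib]
  have key2 : ∀ i ∈ Finset.range (m+1+1),
      ((stepSeq (m+1) a i : ℕ) : ℝ) * ((m+1).choose i : ℝ) * q^i * (t-q)^(m+1-i) =
      (i:ℝ) * a (i-1) * ((m+1).choose i : ℝ) * q^i * (t-q)^(m+1-i) +
      ((m+1-i : ℕ):ℝ) * a i * ((m+1).choose i : ℝ) * q^i * (t-q)^(m+1-i) := by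
    intro i _
    unfold stepSeq
    push_cast
    ring
  rw [Finset.sum_congr rfl key2, Finset.sum_add_distrib]
  congr 1
  · rw [Finset.sum_range_succ' _ (m+1)]
    simp
  · rw [Finset.sum_range_succ _ (m+1)]
    simp

theorem bern_iter (m : ℕ) (a : ℕ → ℕ) (q t : ℝ) (r : ℕ) :
    ((m+r).factorial : ℝ) * (t ^ r * bern m a q t) =
      (m.factorial : ℝ) * bern (m+r) (iterSeq (m+1) a r) q t := by
  induction r with
  | zero => simp [iterSeq]
  | succ r ih =>
    have := bern_step (m+r) (iterSeq (m+1) a r) q t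
    rw [iterSeq, show m + 1 + r = m + r + 1 by ring, ← add_assoc, ← this,
      Nat.factorial_succ]
    push_cast at *
    linear_combination ((m:ℝ)+r+1) * t * ih

theorem bern_integral (m : ℕ) (a : ℕ → ℕ) (ha : a (m+1) = 0) (q u : ℝ) :
    ((m:ℝ)+1) * ∫ t in q..u, bern m a q t = bern (m+1) a q u := by
  unfold bern
  rw [intervalIntegral.integral_finsetSum, Finset.sum_range_succ _ (m+1), ha, Finset.mul_sum]
  · simp only [Nat.cast_zero, zero_mul, add_zero]
    refine Finset.sum_congr rfl fun i hi => ?_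
    have hi' : i ≤ m := by simpa [Nat.lt_succ_iff] using hi
    have c2 : ((m:ℝ)+1) * (m.choose i : ℝ) = ((m+1).choose i : ℝ) * ((m+1-i : ℕ):ℝ) := by
      have := Nat.choose_mul_succ_eq m i
      rw [mul_comm]
      exact_mod_cast this
    rw [intervalIntegral.integral_const_mul,
      intervalIntegral.integral_comp_sub_right (fun x => x ^ (m-i)) q, integral_pow]
    rw [show m + 1 - i = (m - i) + 1 by omega] at *
    have hpos : ((m - i : ℕ) : ℝ) + 1 ≠ 0 := by positivity
    push_cast at c2
    simp only [sub_self, zero_pow (Nat.succ_ne_zero _), sub_zero]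
    field_simp
    linear_combination (a i : ℝ) * q^i * (u-q)^(m-i+1) * c2
  · intro i _
    apply Continuous.intervalIntegrable
    fun_prop

theorem bern_mul (m : ℕ) (c : ℕ) (a : ℕ → ℕ) (q t : ℝ) :
    bern m (fun j => c * a j) q t = c * bern m a q t := by
  unfold bern
  rw [Finset.mul_sum]
  refine Finset.sum_congr rfl fun i _ => ?_
  push_cast; ring

theorem gAux_eq {k : ℕ} (d : Fin k → ℕ) (q u : ℝ) :
    gAux (List.ofFn fun i => d i + 1).reverse q u =
      ((∏ i, (Nat.factorial (d i) : ℝ)) / (Nat.factorial (∑ i, (d i + 1)) : ℝ)) *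
        bern (∑ i, (d i + 1)) (fun j => numExt d (j+1)) q u := by
  induction k generalizing u with
  | zero => simp [gAux, bern, numExt_base]
  | succ k ih =>
    have hrec := numExt_rec d
    rw [List.ofFn_succ', List.concat_eq_append, List.reverse_append]
    simp only [List.reverse_cons, List.reverse_nil, List.nil_append, List.cons_append, gAux,
      Nat.add_sub_cancel]
    have ih' := ih (fun i => d i.castSucc)
    simp only [ih']
    rw [Fin.prod_univ_castSucc, Fin.sum_univ_castSucc]
    have hz : numExt d (∑ i : Fin k, (d i.castSucc + 1) + d (Fin.last k) + 1 + 1) = 0 := by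
      have := (LC_iter (numExt_LC (fun i : Fin k => d i.castSucc))
        (fun i hi => numExt_zero _ i hi) (d (Fin.last k))).2
        (∑ i : Fin k, (d i.castSucc + 1) + d (Fin.last k) + 1) (by omega)
      rw [← hrec] at this
      rcases Nat.mul_eq_zero.1 this with h | h
      · exact absurd h (Nat.factorial_ne_zero _)
      · exact h
    generalize (∑ i : Fin k, (d i.castSucc + 1)) = m at *
    generalize (∏ i : Fin k, ((d i.castSucc).factorial : ℝ)) = P at *
    generalize d (Fin.last k) = r at *
    generalize (fun j => numExt (fun i : Fin k => d i.castSucc) (j+1)) = a at *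
    have hm : (m.factorial : ℝ) ≠ 0 := by positivity
    have hmr : ((m+r).factorial : ℝ) ≠ 0 := by positivity
    have hint : ∀ t : ℝ, t ^ r * (P / (m.factorial : ℝ) * bern m a q t) =
        P / ((m+r).factorial : ℝ) * r.factorial *
          bern (m+r) (fun j => numExt d (j+1)) q t := by
      intro t
      have := bern_iter m a q t r
      rw [← hrec, bern_mul] at this
      field_simp
      linear_combination P * this
    simp only [hint]
    rw [intervalIntegral.integral_const_mul, ← add_assoc,
      ← bern_integral (m+r) _ hz, Nat.factorial_succ]
    push_cast
    have : (m:ℝ)+r+1 ≠ 0 := by positivity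
    field_simp

theorem composition_polynomial_linear_extensions {k : ℕ} (d : Fin k → ℕ) :
    (∀ q : ℝ, gcomp (List.ofFn fun i => d i + 1) q =
      ((∏ i, (Nat.factorial (d i) : ℝ)) / (Nat.factorial (∑ i, (d i + 1)) : ℝ)) *
        ∑ i ∈ Finset.range (∑ i, (d i + 1) + 1),
          (numExt d (i + 1) : ℝ) * ((∑ i, (d i + 1)).choose i : ℝ) *
            q ^ i * (1 - q) ^ (∑ i, (d i + 1) - i)) ∧
    (∀ j : ℕ, 2 ≤ j → j ≤ ∑ i, (d i + 1) →
      numExt d (j - 1) * numExt d (j + 1) ≤ numExt d j ^ 2) := by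
  refine ⟨fun q => gAux_eq d q 1, ?_⟩
  intro j hj _
  obtain ⟨i, rfl⟩ := Nat.exists_eq_add_of_le' hj
  exact (numExt_LC d).1 i
end
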